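/- arXiv:1904.10518 — 8 statements merged into one kernel-verified Lean document; each statement's English description precedes it below -/
import Mathlib

section
/- Let D be a nontrivial 2-(v,k,λ) design with prime replication number r, and let G be a flag-transitive automorphism group of D. Then λ·v < r². -/
open Pointwise

variable {P : Type*}

/-- `blocks` is the block set of a 2-(v,k,lam) design on the point set `P`:
`P` has `v ≥ 2` points, every block is a `k`-subset of `P`, and every pair of
distinct points lies in exactly `lam ≥ 1` common blocks. -/
def IsTwoDesign [Fintype P] [DecidableEq P] (blocks : Finset (Finset P))
    (v k lam : ℕ) : Prop :=
  Fintype.card P = v ∧ 2 ≤ v ∧ 1 ≤ lam ∧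
    (∀ B ∈ blocks, B.card = k) ∧
    ∀ x y : P, x ≠ y → (blocks.filter fun B => x ∈ B ∧ y ∈ B).card = lam

/-- The number of blocks containing a given point `x`. -/
def pointDegree [DecidableEq P] (blocks : Finset (Finset P)) (x : P) : ℕ :=
  (blocks.filter fun B => x ∈ B).card

/-- `G` is a group of automorphisms of the design with block set `blocks`:
every element of `G` is a permutation of the points mapping blocks to blocks. -/
def IsAutGroup [DecidableEq P] (blocks : Finset (Finset P))
    (G : Subgroup (Equiv.Perm P)) : Prop :=
  ∀ g ∈ G, ∀ B ∈ blocks, B.image g ∈ blocks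

/-- `G` acts transitively on the flags (incident point-block pairs) of the design. -/
def IsFlagTransitive [DecidableEq P] (blocks : Finset (Finset P))
    (G : Subgroup (Equiv.Perm P)) : Prop :=
  ∀ B₁ ∈ blocks, ∀ B₂ ∈ blocks, ∀ x₁ ∈ B₁, ∀ x₂ ∈ B₂,
    ∃ g ∈ G, g x₁ = x₂ ∧ B₁.image g = B₂

/-- Summing `w` over all flags whose block passes through `x`. -/
theorem sum_blocks_through [Fintype P] [DecidableEq P]
    (blocks : Finset (Finset P)) (lam r : ℕ)
    (hl : ∀ x y : P, x ≠ y → (blocks.filter fun B => x ∈ B ∧ y ∈ B).card = lam)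
    (hrepl : ∀ x : P, pointDegree blocks x = r) (w : P → ℚ) (x : P) :
    ∑ B ∈ blocks.filter (fun B => x ∈ B), ∑ y ∈ B, w y
      = lam * ∑ y, w y + ((r : ℚ) - lam) * w x := by
  have h1 : ∀ B : Finset P, ∑ y ∈ B, w y = ∑ y, if y ∈ B then w y else 0 := by
    intro B
    simp
  simp_rw [h1]
  rw [Finset.sum_comm]
  have h2 : ∀ y, (∑ B ∈ blocks.filter (fun B => x ∈ B), if y ∈ B then w y else 0)
      = lam * w y + if y = x then ((r : ℚ) - lam) * w y else 0 := by
    intro y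
    rw [← Finset.sum_filter, Finset.filter_filter, Finset.sum_const, nsmul_eq_mul]
    by_cases h : y = x
    · subst h
      have := hrepl y
      unfold pointDegree at this
      simp only [and_self, this, if_true]
      ring
    · rw [hl x y (Ne.symm h)]
      simp [h]
  simp_rw [h2]
  rw [Finset.sum_add_distrib, ← Finset.mul_sum]
  simp

/-- For a nontrivial 2-design with prime replication number `r` admitting a
flag-transitive automorphism group, one has `λ * v < r ^ 2`. -/
theorem lam_mul_v_lt_r_sq [Fintype P] [DecidableEq P]
    (blocks : Finset (Finset P)) (v k lam r : ℕ)
    (hD : IsTwoDesign blocks v k lam) (hk : 2 < k) (hkv : k < v - 1)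
    (hr : r.Prime) (hrepl : ∀ x : P, pointDegree blocks x = r)
    (G : Subgroup (Equiv.Perm P)) (hAut : IsAutGroup blocks G)
    (hFT : IsFlagTransitive blocks G) :
    lam * v < r ^ 2 := by
  obtain ⟨hv, hv2, hl1, hB, hl⟩ := hD
  have key := sum_blocks_through blocks lam r hl hrepl
  have hne : Nonempty P := by
    rw [← Fintype.card_pos_iff]
    omega
  obtain ⟨x0⟩ := hne
  -- the basic identity
  have e1 : (r : ℚ) * k = lam * v + (r - lam) := by
    have h := key (fun _ => 1) x0
    have h2 : ∑ B ∈ blocks.filter (fun B => x0 ∈ B), ∑ y ∈ B, (1 : ℚ) = r * k := by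
      rw [← hrepl x0]
      unfold pointDegree
      rw [Finset.sum_congr rfl (g := fun _ => (k : ℚ)), Finset.sum_const, nsmul_eq_mul]
      intro B hBm
      rw [← hB B (Finset.mem_filter.1 hBm).1]
      simp
    rw [h2] at h
    simpa [hv] using h
  have e2 : r * k + lam = lam * v + r := by
    have : (r : ℚ) * k + lam = lam * v + r := by linarith
    exact_mod_cast this
  have hlr : lam < r := by
    obtain ⟨d, rfl⟩ : ∃ d, v = k + d + 1 := ⟨v - k - 1, by omega⟩
    obtain ⟨j, rfl⟩ : ∃ j, k = j + 1 := ⟨k - 1, by omega⟩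
    by_contra hcon
    push Not at hcon
    nlinarith
  -- double counting of flags
  have e3 : blocks.card * k = v * r := by
    have h := Finset.sum_card_bipartiteAbove_eq_sum_card_bipartiteBelow
      (s := blocks) (t := (Finset.univ : Finset P)) (fun B x => x ∈ B)
    have h1 : ∑ B ∈ blocks, (Finset.univ.bipartiteAbove (fun B x => x ∈ B) B).card
        = blocks.card * k := by
      rw [Finset.sum_congr rfl (g := fun _ => k)]
      · simp
      · intro B hBm
        rw [← hB B hBm]
        simp [Finset.bipartiteAbove]
    have h2 : ∑ x : P, (blocks.bipartiteBelow (fun B x => x ∈ B) x).card = v * r := by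
      rw [Finset.sum_congr rfl (g := fun _ => r)]
      · simp [hv]
      · intro x _
        exact hrepl x
    rw [← h1, ← h2]
    exact h
  -- Fisher's inequality
  have fisher : v ≤ blocks.card := by
    let f : (P → ℚ) →ₗ[ℚ] (blocks → ℚ) :=
      { toFun := fun w B => ∑ y ∈ B.1, w y
        map_add' := by
          intro a b
          ext B
          simp [Finset.sum_add_distrib]
        map_smul' := by
          intro c a
          ext B
          simp [Finset.mul_sum] }
    have hf : Function.Injective f := by
      rw [← LinearMap.ker_eq_bot, LinearMap.ker_eq_bot']
      intro w hw
      have hz : ∀ x, (lam : ℚ) * ∑ y, w y + ((r : ℚ) - lam) * w x = 0 := by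
        intro x
        rw [← key w x]
        apply Finset.sum_eq_zero
        intro B hBm
        exact congrFun hw ⟨B, (Finset.mem_filter.1 hBm).1⟩
      have hlq : (lam : ℚ) < r := by exact_mod_cast hlr
      have hS : ∑ y, w y = 0 := by
        have h : ∑ x : P, ((lam : ℚ) * ∑ y, w y + ((r : ℚ) - lam) * w x) = 0 :=
          Finset.sum_eq_zero fun x _ => hz x
        rw [Finset.sum_add_distrib, ← Finset.mul_sum, ← Finset.mul_sum, Finset.sum_const,
          Finset.card_univ, hv, nsmul_eq_mul] at h
        have h' : ((v : ℚ) * lam + (r - lam)) * ∑ y, w y = 0 := by linarith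
        rcases mul_eq_zero.1 h' with h0 | h0
        · exfalso
          have : (0 : ℚ) ≤ (v : ℚ) * lam := by positivity
          linarith
        · exact h0
      ext x
      have h := hz x
      rw [hS, mul_zero, zero_add] at h
      rcases mul_eq_zero.1 h with h0 | h0
      · exfalso
        linarith
      · exact h0
    have h := LinearMap.finrank_le_finrank_of_injective hf
    simpa [hv] using h
  have hkr : k ≤ r := by
    have h : v * k ≤ v * r := by
      rw [← e3]
      exact Nat.mul_le_mul_right k fisher
    exact Nat.le_of_mul_le_mul_left h (by omega)
  nlinarith
end

section
/- Let D be a nontrivial 2-(v,k,λ) design with prime replication number r, let G be a flag-transitive automorphism group of D, and let α be a point of D. Then for every point β ≠ α, the prime r divides the cardinality of the orbit of β under the point stabilizer G_α (that is, r divides every nontrivial subdegree of G). -/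
open Pointwise

variable {P : Type*}

/-- For a nontrivial 2-design with prime replication number `r` admitting a
flag-transitive automorphism group `G`, the prime `r` divides every nontrivial
subdegree of `G`, i.e. the size of the `G_α`-orbit of any point `β ≠ α`. -/
theorem replication_dvd_subdegrees [Fintype P] [DecidableEq P]
    (blocks : Finset (Finset P)) (v k lam r : ℕ)
    (hD : IsTwoDesign blocks v k lam) (hk : 2 < k) (hkv : k < v - 1)
    (hr : r.Prime) (hrepl : ∀ x : P, pointDegree blocks x = r)
    (G : Subgroup (Equiv.Perm P)) (hAut : IsAutGroup blocks G)
    (hFT : IsFlagTransitive blocks G) (α β : P) (hβ : β ≠ α) :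
    r ∣ Nat.card (MulAction.orbit (MulAction.stabilizer G α) β) := by
  classical
  obtain ⟨hv, -, hl, hB, hp⟩ := hD
  set S := blocks.filter fun B => α ∈ B with hS
  have hSr : S.card = r := hrepl α
  obtain ⟨B₀, hB₀⟩ : S.Nonempty := by
    rw [← Finset.card_pos, hSr]; exact hr.pos
  have hB₀' := Finset.mem_filter.1 hB₀
  have hfil : ∀ y : P, y ≠ α → (S.filter fun B => y ∈ B).card = lam := by
    intro y hy
    rw [hS, Finset.filter_filter]
    exact hp α y hy.symm
  -- the index of intersection is smaller than the replication number
  have hlt : lam < r := by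
    by_contra hge
    have huniv : B₀ = Finset.univ := by
      ext y
      simp only [Finset.mem_univ, iff_true]
      by_cases hy : y = α
      · rw [hy]; exact hB₀'.2
      · have h1 := Finset.eq_of_subset_of_card_le
          (Finset.filter_subset (fun B => y ∈ B) S) (by rw [hfil y hy, hSr]; omega)
        rw [← h1] at hB₀
        exact (Finset.mem_filter.1 hB₀).2
    have h2 := hB B₀ hB₀'.1
    rw [huniv, Finset.card_univ, hv] at h2
    omega
  set O : Finset P :=
    Finset.univ.filter fun x => x ∈ MulAction.orbit (MulAction.stabilizer G α) β with hO
  have hcard : Nat.card (MulAction.orbit (MulAction.stabilizer G α) β) = O.card := by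
    rw [hO, Nat.card_eq_fintype_card, Fintype.card_subtype]
  have hαO : ∀ y ∈ O, y ≠ α := by
    rintro y hy rfl
    obtain ⟨g, hg⟩ := (Finset.mem_filter.1 hy).2
    have hg' : (g : G) • β = y := hg
    have h3 : (g : G) • y = y := g.2
    exact hβ (MulAction.injective (g : G) (hg'.trans h3.symm))
  -- each block through the point meets the orbit in the same number of points
  have hconst : ∀ B ∈ S, (O.filter fun y => y ∈ B).card
      = (O.filter fun y => y ∈ B₀).card := by
    intro B hBS
    have hB' := Finset.mem_filter.1 hBS
    obtain ⟨g, hgG, hgα, hgB⟩ := hFT B₀ hB₀'.1 B hB'.1 α hB₀'.2 α hB'.2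
    have hst : (⟨g, hgG⟩ : G) ∈ MulAction.stabilizer G α := hgα
    have hmem : ∀ y, g y ∈ O ↔ y ∈ O := by
      intro y
      simp only [hO, Finset.mem_filter, Finset.mem_univ, true_and]
      let h : MulAction.stabilizer G α := ⟨⟨g, hgG⟩, hst⟩
      change h • y ∈ _ ↔ _
      rw [← MulAction.orbit_eq_iff, ← MulAction.orbit_eq_iff, MulAction.orbit_smul]
    have him : (O.filter fun y => y ∈ B) = (O.filter fun y => y ∈ B₀).image g := by
      ext y
      simp only [Finset.mem_filter, Finset.mem_image, ← hgB]
      constructor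
      · rintro ⟨h1, x, hx, rfl⟩
        exact ⟨x, ⟨(hmem x).1 h1, hx⟩, rfl⟩
      · rintro ⟨x, ⟨h1, hx⟩, rfl⟩
        exact ⟨(hmem x).2 h1, x, hx, rfl⟩
    rw [him, Finset.card_image_of_injective _ g.injective]
  have hdc := Finset.sum_card_bipartiteAbove_eq_sum_card_bipartiteBelow
    (s := O) (t := S) (fun y B => y ∈ B)
  simp only [Finset.bipartiteAbove, Finset.bipartiteBelow] at hdc
  rw [Finset.sum_congr rfl (fun y hy => hfil y (hαO y hy)),
    Finset.sum_congr rfl hconst, Finset.sum_const, Finset.sum_const, hSr,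
    smul_eq_mul, smul_eq_mul] at hdc
  rw [hcard]
  have hd : r ∣ O.card * lam := ⟨_, hdc⟩
  rcases hr.dvd_mul.1 hd with h | h
  · exact h
  · exact absurd (Nat.le_of_dvd hl h) (by omega)
end

section
/- Let D be a nontrivial 2-(v,k,λ) design with prime replication number r, let G be a flag-transitive automorphism group of D, and let α be a point of D. Then |G| ≤ |G_α|³. -/
open Pointwise

variable {P : Type*}

lemma design_sum [Fintype P] [DecidableEq P] (blocks : Finset (Finset P)) (v k lam r : ℕ)
    (hD : IsTwoDesign blocks v k lam) (hrepl : ∀ x : P, pointDegree blocks x = r)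
    (w : P → ℚ) (x : P) :
    ∑ B ∈ blocks.filter (fun B => x ∈ B), ∑ y ∈ B, w y =
      ((r : ℚ) - lam) * w x + lam * ∑ y, w y := by
  obtain ⟨-, -, -, -, hl⟩ := hD
  have h1 : ∀ B : Finset P, ∑ y ∈ B, w y = ∑ y, if y ∈ B then w y else 0 := by
    intro B
    simp
  simp only [h1]
  rw [Finset.sum_comm]
  have h2 : ∀ y, (∑ B ∈ blocks.filter (fun B => x ∈ B), if y ∈ B then w y else 0) =
      (if y = x then ((r : ℚ) - lam) * w x else 0) + lam * w y := by
    intro y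
    rw [← Finset.sum_filter, Finset.sum_const, Finset.filter_filter, nsmul_eq_mul]
    by_cases h : y = x
    · subst h
      have := hrepl y
      unfold pointDegree at this
      simp only [and_self, this, if_true]
      ring
    · rw [hl x y (Ne.symm h)]
      simp [h]
  simp only [h2, Finset.sum_add_distrib, Finset.mul_sum]
  simp

lemma design_fisher [Fintype P] [DecidableEq P] (blocks : Finset (Finset P)) (v k lam r : ℕ)
    (hD : IsTwoDesign blocks v k lam) (hrepl : ∀ x : P, pointDegree blocks x = r)
    (hlr : lam < r) : v ≤ blocks.card := by
  let f : (P → ℚ) →ₗ[ℚ] (blocks → ℚ) :=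
    { toFun := fun w B => ∑ y ∈ B.1, w y
      map_add' := by
        intro a b
        ext B
        simp [Finset.sum_add_distrib]
      map_smul' := by
        intro a b
        ext B
        simp [Finset.mul_sum] }
  have hinj : Function.Injective f := by
    rw [injective_iff_map_eq_zero]
    intro w hw
    have hB : ∀ B ∈ blocks, ∑ y ∈ B, w y = 0 := fun B hB => congrFun hw ⟨B, hB⟩
    have hx : ∀ x, ((r : ℚ) - lam) * w x + lam * ∑ y, w y = 0 := by
      intro x
      rw [← design_sum blocks v k lam r hD hrepl w x]
      exact Finset.sum_eq_zero fun B h => hB B (Finset.mem_filter.1 h).1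
    have hpos : (0 : ℚ) < (r : ℚ) - lam := by
      have : (lam : ℚ) < r := by exact_mod_cast hlr
      linarith
    have hs : (((r : ℚ) - lam) + (Fintype.card P : ℚ) * lam) * ∑ y, w y = 0 := by
      have := Finset.sum_eq_zero (s := Finset.univ) fun x _ => hx x
      rw [Finset.sum_add_distrib, ← Finset.mul_sum, Finset.sum_const, nsmul_eq_mul,
        Finset.card_univ] at this
      linarith
    have hS : ∑ y, w y = 0 := by
      rcases mul_eq_zero.1 hs with h | h
      · have : (0 : ℚ) ≤ (Fintype.card P : ℚ) * lam := by positivity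
        linarith
      · exact h
    ext x
    have := hx x
    rw [hS, mul_zero, add_zero] at this
    exact (mul_eq_zero.1 this).resolve_left hpos.ne'
  have := LinearMap.finrank_le_finrank_of_injective hinj
  simpa [hD.1] using this

lemma design_bk [Fintype P] [DecidableEq P] (blocks : Finset (Finset P)) (v k lam r : ℕ)
    (hD : IsTwoDesign blocks v k lam) (hrepl : ∀ x : P, pointDegree blocks x = r) :
    blocks.card * k = v * r := by
  have h := Finset.sum_card_bipartiteAbove_eq_sum_card_bipartiteBelow
    (s := (Finset.univ : Finset P)) (t := blocks) (fun x B => x ∈ B)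
  have h1 : ∀ x ∈ (Finset.univ : Finset P),
      (Finset.bipartiteAbove (fun (x : P) B => x ∈ B) blocks x).card = r :=
    fun x _ => hrepl x
  have h2 : ∀ B ∈ blocks,
      (Finset.bipartiteBelow (fun (x : P) B => x ∈ B) Finset.univ B).card = k := by
    intro B hB
    rw [← hD.2.2.2.1 B hB]
    simp [Finset.bipartiteBelow]
  rw [Finset.sum_congr rfl h1, Finset.sum_congr rfl h2] at h
  simp [hD.1] at h
  exact h.symm

/-- For a nontrivial 2-design with prime replication number admitting a
flag-transitive automorphism group `G`, one has `|G| ≤ |G_α|³` for any point `α`. -/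
theorem card_le_cube_card_stabilizer [Fintype P] [DecidableEq P]
    (blocks : Finset (Finset P)) (v k lam r : ℕ)
    (hD : IsTwoDesign blocks v k lam) (hk : 2 < k) (hkv : k < v - 1)
    (hr : r.Prime) (hrepl : ∀ x : P, pointDegree blocks x = r)
    (G : Subgroup (Equiv.Perm P)) (hAut : IsAutGroup blocks G)
    (hFT : IsFlagTransitive blocks G) (α : P) :
    Nat.card G ≤ Nat.card (MulAction.stabilizer G α) ^ 3 := by
  -- basic counting identity
  have hcount : (r : ℤ) * k = (r - lam) + lam * v := by
    have h := design_sum blocks v k lam r hD hrepl (fun _ => 1) α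
    have h2 : ∑ B ∈ blocks.filter (fun B => α ∈ B), ∑ y ∈ B, (1 : ℚ) = r * k := by
      have : ∀ B ∈ blocks.filter (fun B => α ∈ B), ∑ y ∈ B, (1 : ℚ) = k := by
        intro B hB
        simp [hD.2.2.2.1 B (Finset.mem_filter.1 hB).1]
      rw [Finset.sum_congr rfl this, Finset.sum_const, nsmul_eq_mul]
      have := hrepl α
      unfold pointDegree at this
      rw [this]
    rw [h2] at h
    simp [hD.1] at h
    exact_mod_cast h
  have hlam : 1 ≤ lam := hD.2.2.1
  have hrpos : 0 < r := hr.pos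
  have hkv' : k + 2 ≤ v := by omega
  have hlr : lam < r := by
    by_contra hc
    push Not at hc
    zify at *
    nlinarith [mul_le_mul_of_nonneg_right hc (show (0 : ℤ) ≤ v - 1 by linarith)]
  have hF := design_fisher blocks v k lam r hD hrepl hlr
  have hbk := design_bk blocks v k lam r hD hrepl
  have hkr : k ≤ r := by
    have : v * k ≤ v * r := hbk ▸ Nat.mul_le_mul_right k hF
    exact Nat.le_of_mul_le_mul_left this (by omega)
  have hvr : v ≤ r ^ 2 := by
    zify at *
    nlinarith [mul_le_mul_of_nonneg_right hlam (show (0 : ℤ) ≤ v - 1 by linarith),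
      mul_le_mul_of_nonneg_left hkr hrpos.le]
  -- the stabilizer is transitive on the blocks through `α`
  have hrs : r ≤ Nat.card (MulAction.stabilizer G α) := by
    have hne : (blocks.filter fun B => α ∈ B).Nonempty := by
      rw [← Finset.card_pos]
      have := hrepl α
      unfold pointDegree at this
      omega
    obtain ⟨B₀, hB₀⟩ := hne
    obtain ⟨hB₀, hα₀⟩ := Finset.mem_filter.1 hB₀
    classical
    haveI : Fintype (MulAction.stabilizer G α) := Fintype.ofFinite _
    rw [← hrepl α, Nat.card_eq_fintype_card, ← Finset.card_univ]
    unfold pointDegree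
    apply Finset.card_le_card_of_surjOn
      (fun g : MulAction.stabilizer G α => B₀.image (g.1.1 : Equiv.Perm P))
    intro B hB
    obtain ⟨hB, hα⟩ := Finset.mem_filter.1 (Finset.mem_coe.1 hB)
    obtain ⟨g, hg, hgα, hgB⟩ := hFT B₀ hB₀ B hB α hα₀ α hα
    exact ⟨⟨⟨g, hg⟩, hgα⟩, by simp, hgB⟩
  have hG : Nat.card G ≤ v * Nat.card (MulAction.stabilizer G α) := by
    rw [← (MulAction.stabilizer G α).index_mul_card, MulAction.index_stabilizer]
    apply Nat.mul_le_mul_right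
    rw [← hD.1, ← Nat.card_eq_fintype_card]
    exact Set.ncard_le_card _
  calc Nat.card G ≤ v * Nat.card (MulAction.stabilizer G α) := hG
    _ ≤ Nat.card (MulAction.stabilizer G α) ^ 2 * Nat.card (MulAction.stabilizer G α) :=
        Nat.mul_le_mul_right _ (hvr.trans (Nat.pow_le_pow_left hrs 2))
    _ = _ := by ring
end

section
/- Let D be a nontrivial 2-(v,k,λ) design whose replication number r is prime, and let G be a flag-transitive automorphism group of D. Then G acts primitively on the point set P of D (it acts transitively and preserves no nontrivial partition of P; equivalently, each point stabilizer G_α is a maximal subgroup of G). -/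
open Pointwise

variable {P : Type*}

/-- Weighted double count of the blocks through `x`. -/
lemma weighted_count [Fintype P] [DecidableEq P] (blocks : Finset (Finset P)) (lam r : ℕ)
    (hl : ∀ x y : P, x ≠ y → (blocks.filter fun B => x ∈ B ∧ y ∈ B).card = lam)
    (hrepl : ∀ x : P, pointDegree blocks x = r) (w : P → ℚ) (x : P) :
    ∑ B ∈ blocks.filter (fun B => x ∈ B), ∑ y ∈ B, w y
      = (r - lam) * w x + lam * ∑ y, w y := by
  have h1 : ∀ B : Finset P, ∑ y ∈ B, w y = ∑ y, if y ∈ B then w y else 0 := by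
    intro B
    simp
  simp_rw [h1]
  rw [Finset.sum_comm]
  have h2 : ∀ y, (∑ B ∈ blocks.filter (fun B => x ∈ B), if y ∈ B then w y else 0)
      = lam * w y + if y = x then (r - lam) * w x else 0 := by
    intro y
    rw [← Finset.sum_filter, Finset.filter_filter, Finset.sum_const, nsmul_eq_mul]
    by_cases h : y = x
    · subst h
      have := hrepl y
      unfold pointDegree at this
      simp only [and_self, this, if_true]
      ring
    · rw [hl x y (Ne.symm h)]
      simp [h]
  simp_rw [h2]
  rw [Finset.sum_add_distrib, ← Finset.mul_sum]
  simp
  ring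

/-- Fisher's inequality. -/
lemma fisher [Fintype P] [DecidableEq P] (blocks : Finset (Finset P)) (k lam r : ℕ)
    (hb : ∀ B ∈ blocks, B.card = k)
    (hl : ∀ x y : P, x ≠ y → (blocks.filter fun B => x ∈ B ∧ y ∈ B).card = lam)
    (hrepl : ∀ x : P, pointDegree blocks x = r) (hlr : lam < r) :
    Fintype.card P ≤ blocks.card := by
  by_contra hlt
  push Not at hlt
  let L : (P → ℚ) →ₗ[ℚ] (blocks → ℚ) :=
    { toFun := fun w B => ∑ y ∈ B.1, w y
      map_add' := by
        intro a b
        ext B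
        simp [Finset.sum_add_distrib]
      map_smul' := by
        intro a b
        ext B
        simp [Finset.mul_sum] }
  have hker : LinearMap.ker L ≠ ⊥ := by
    apply LinearMap.ker_ne_bot_of_finrank_lt
    simpa using hlt
  obtain ⟨w, hw, hw0⟩ := (Submodule.ne_bot_iff _).1 hker
  apply hw0
  have hB : ∀ B ∈ blocks, ∑ y ∈ B, w y = 0 := fun B h =>
    congrFun (LinearMap.mem_ker.1 hw) ⟨B, h⟩
  have hx : ∀ x, ((r : ℚ) - lam) * w x + lam * ∑ y, w y = 0 := by
    intro x
    rw [← weighted_count blocks lam r hl hrepl w x]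
    exact Finset.sum_eq_zero fun B h => hB B (Finset.mem_filter.1 h).1
  have hpos : (0 : ℚ) < (r : ℚ) - lam := by
    have : (lam : ℚ) < r := by exact_mod_cast hlr
    linarith
  have hsum : ∑ y, w y = 0 := by
    have h := Finset.sum_congr (rfl : (Finset.univ : Finset P) = _) (fun x _ => hx x)
    rw [Finset.sum_add_distrib, ← Finset.mul_sum] at h
    simp only [Finset.sum_const, nsmul_eq_mul, mul_zero] at h
    have h3 : (((r : ℚ) - lam) + (Finset.univ : Finset P).card * lam) * ∑ y, w y = 0 := by
      linarith
    rcases mul_eq_zero.1 h3 with h4 | h4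
    · have : (0 : ℚ) ≤ (Finset.univ : Finset P).card * lam := by positivity
      linarith
    · exact h4
  ext x
  have := hx x
  rw [hsum] at this
  simp only [mul_zero, add_zero] at this
  rcases mul_eq_zero.1 this with h | h
  · linarith
  · simpa using h

lemma flag_count [Fintype P] [DecidableEq P] (blocks : Finset (Finset P)) (k r : ℕ)
    (hb : ∀ B ∈ blocks, B.card = k)
    (hrepl : ∀ x : P, pointDegree blocks x = r) :
    Fintype.card P * r = blocks.card * k := by
  have h := Finset.sum_card_bipartiteAbove_eq_sum_card_bipartiteBelow
    (s := (Finset.univ : Finset P)) (t := blocks) (fun x B => x ∈ B)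
  have e1 : ∑ x : P, (blocks.bipartiteAbove (fun x B => x ∈ B) x).card
      = Fintype.card P * r := by
    rw [Finset.sum_congr rfl (g := fun _ => r)]
    · simp
    · intro x _
      exact hrepl x
  have e2 : ∑ B ∈ blocks, ((Finset.univ : Finset P).bipartiteBelow (fun x B => x ∈ B) B).card
      = blocks.card * k := by
    rw [Finset.sum_congr rfl (g := fun _ => k)]
    · simp
    · intro B hB
      rw [← hb B hB]
      simp [Finset.bipartiteBelow]
  rw [← e1, ← e2]
  exact h

lemma set_count [Fintype P] [DecidableEq P] (blocks : Finset (Finset P)) (lam r l : ℕ)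
    (hl : ∀ x y : P, x ≠ y → (blocks.filter fun B => x ∈ B ∧ y ∈ B).card = lam)
    (hrepl : ∀ x : P, pointDegree blocks x = r) (T : Finset P) (x : P) (hx : x ∈ T)
    (hT : ∀ B ∈ blocks, x ∈ B → (B ∩ T).card = l) :
    r * l + lam = r + lam * T.card := by
  have h := weighted_count blocks lam r hl hrepl (fun y => if y ∈ T then 1 else 0) x
  rw [Finset.sum_congr rfl (g := fun _ => (l : ℚ))] at h
  · have h2 := hrepl x
    unfold pointDegree at h2
    simp only [Finset.sum_const, nsmul_eq_mul, h2, hx, if_true] at h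
    have h3 : (∑ y : P, if y ∈ T then (1 : ℚ) else 0) = T.card := by simp
    rw [h3] at h
    have : (r * l + lam : ℚ) = r + lam * T.card := by linarith
    exact_mod_cast this
  · intro B hB
    rw [Finset.mem_filter] at hB
    rw [← hT B hB.1 hB.2]
    simp

lemma arith (v k lam r l c : ℕ) (hr : r.Prime) (hlam : 1 ≤ lam) (hlr : lam < r)
    (hkr : k ≤ r) (h1 : r * k + lam = r + lam * v) (h2 : r * l + lam = r + lam * c)
    (hc : 1 < c) (hcv : c < v) (hd : c ∣ v) : False := by
  obtain ⟨d, rfl⟩ := hd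
  have key : ∀ a n : ℕ, 1 ≤ n → r * a + lam = r + lam * n → r ∣ n - 1 := by
    intro a n hn h
    obtain ⟨m, rfl⟩ := Nat.exists_eq_add_of_le hn
    have h3 : r ∣ lam * m := by
      have h4 : r * a = r + lam * m := by linarith
      exact (Nat.dvd_add_right (dvd_refl r)).1 (h4 ▸ dvd_mul_right r a)
    rw [Nat.add_sub_cancel_left]
    exact (hr.dvd_mul.1 h3).resolve_left (fun h => by
      have := Nat.le_of_dvd hlam h
      omega)
  have hd2 : 2 ≤ d := by
    by_contra hh
    interval_cases d <;> omega
  obtain ⟨m, hm⟩ := key l c (by omega) h2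
  obtain ⟨n, hn⟩ := key k (c * d) (by omega) h1
  have hc' : c = r * m + 1 := by omega
  have hv' : c * d = r * n + 1 := by omega
  have hde : r ∣ d - 1 := by
    obtain ⟨e, rfl⟩ := Nat.exists_eq_add_of_le (show 1 ≤ d by omega)
    rw [Nat.add_sub_cancel_left]
    rw [hc'] at hv'
    have h5 : r * (m * (1 + e)) + e = r * n := by nlinarith
    exact (Nat.dvd_add_right (dvd_mul_right r _)).1 (h5 ▸ dvd_mul_right r n)
  have hdr := Nat.le_of_dvd (by omega) hde
  have hcr : r ≤ c - 1 := Nat.le_of_dvd (by omega) ⟨m, hm⟩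
  have h6 : (r + 1) * (r + 1) ≤ c * d := Nat.mul_le_mul (by omega) (by omega)
  have h7 : 1 * (c * d) ≤ lam * (c * d) := Nat.mul_le_mul_right _ hlam
  have h8 : r * k ≤ r * r := Nat.mul_le_mul_left _ hkr
  nlinarith

/-- A flag-transitive automorphism group of a nontrivial 2-design with prime
replication number is point-primitive: it is transitive on points and every
block of imprimitivity for its action is trivial. -/
theorem flag_transitive_point_primitive [Fintype P] [DecidableEq P]
    (blocks : Finset (Finset P)) (v k lam r : ℕ)
    (hD : IsTwoDesign blocks v k lam) (hk : 2 < k) (hkv : k < v - 1)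
    (hr : r.Prime) (hrepl : ∀ x : P, pointDegree blocks x = r)
    (G : Subgroup (Equiv.Perm P)) (hAut : IsAutGroup blocks G)
    (hFT : IsFlagTransitive blocks G) :
    MulAction.IsPretransitive G P ∧
      ∀ s : Set P, MulAction.IsBlock G s → s.Subsingleton ∨ s = Set.univ := by
  obtain ⟨hv, hv2, hlam, hb, hl⟩ := hD
  have hr0 := hr.pos
  have hex : ∀ x : P, ∃ B ∈ blocks, x ∈ B := by
    intro x
    have h : 0 < (blocks.filter fun B => x ∈ B).card := by
      have := hrepl x
      unfold pointDegree at this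
      omega
    obtain ⟨B, hB⟩ := Finset.card_pos.1 h
    exact ⟨B, (Finset.mem_filter.1 hB).1, (Finset.mem_filter.1 hB).2⟩
  have htr : MulAction.IsPretransitive G P := by
    constructor
    intro x y
    obtain ⟨B, hB, hx⟩ := hex x
    obtain ⟨C, hC, hy⟩ := hex y
    obtain ⟨g, hg, hgx, -⟩ := hFT B hB C hC x hx y hy
    exact ⟨⟨g, hg⟩, hgx⟩
  refine ⟨htr, ?_⟩
  intro s hs
  by_contra hcon
  push Not at hcon
  obtain ⟨hns, hsu⟩ := hcon
  obtain ⟨x, hx, y, hy, hxy⟩ := hns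
  classical
  set T : Finset P := s.toFinset with hTdef
  have hxT : x ∈ T := by simpa [hTdef] using hx
  have hyT : y ∈ T := by simpa [hTdef] using hy
  have hTc : s.ncard = T.card := Set.ncard_eq_toFinset_card' s
  have hc : 1 < T.card := Finset.one_lt_card.2 ⟨x, hxT, y, hyT, hxy⟩
  have hcv : T.card < v := by
    rw [← hv]
    refine Finset.card_lt_univ_of_notMem (x := ((Set.ne_univ_iff_exists_notMem s).1 hsu).choose) ?_
    simpa [hTdef] using ((Set.ne_univ_iff_exists_notMem s).1 hsu).choose_spec
  have hdvd : T.card ∣ v := by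
    have := hs.ncard_dvd_card ⟨x, hx⟩
    rwa [hTc, Nat.card_eq_fintype_card, hv] at this
  have h1 : r * k + lam = r + lam * v := by
    rw [← hv]
    refine set_count blocks lam r k hl hrepl Finset.univ x (Finset.mem_univ _) ?_
    intro B hB _
    simpa using hb B hB
  have hlr : lam < r := by
    by_contra h
    push Not at h
    have : r * (v - 1) ≤ lam * (v - 1) := Nat.mul_le_mul_right _ h
    obtain ⟨u, rfl⟩ := Nat.exists_eq_add_of_le (show 1 ≤ v by omega)
    rw [Nat.add_sub_cancel_left] at this hkv
    nlinarith
  have hkr : k ≤ r := by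
    have hf := fisher blocks k lam r hb hl hrepl hlr
    have hfc := flag_count blocks k r hb hrepl
    rw [hv] at hf hfc
    have : v * k ≤ v * r := hfc ▸ Nat.mul_le_mul_right k hf
    exact Nat.le_of_mul_le_mul_left this (by omega)
  obtain ⟨B₀, hB₀, hx₀⟩ := hex x
  refine arith v k lam r (B₀ ∩ T).card T.card hr hlam hlr hkr h1 ?_ hc hcv hdvd
  refine set_count blocks lam r _ hl hrepl T x hxT ?_
  intro B hB hxB
  obtain ⟨g, hg, hgx, hgB⟩ := hFT B₀ hB₀ B hB x hx₀ x hxB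
  have hgs : (⟨g, hg⟩ : G) • s = s := hs.smul_eq_of_mem hx (by
    change g x ∈ s
    rwa [hgx])
  have hgT : T.image g = T := by
    apply Finset.coe_injective
    rw [Finset.coe_image, hTdef, Set.coe_toFinset]
    exact hgs
  calc (B ∩ T).card = (B₀.image g ∩ T.image g).card := by rw [hgB, hgT]
    _ = ((B₀ ∩ T).image g).card := by rw [Finset.image_inter _ _ g.injective]
    _ = (B₀ ∩ T).card := Finset.card_image_of_injective _ g.injective
end

section
/- Let D be a nontrivial 2-(v,k,λ) design whose replication number r is prime, and let G be a flag-transitive automorphism group of D. Then G is point-primitive of almost simple or affine type: either G has a normal subgroup N that is elementary abelian (abelian with all nontrivial elements of order a fixed prime p) and acts regularly on the point set P, or G has a normal subgroup X that is nonabelian simple and whose centralizer in G is trivial. -/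
open Pointwise

variable {P : Type*}

namespace FlagPrime

/-- Fixed point count on an invariant set for a permutation of prime order. -/
theorem ncard_modEq {X : Type*} [Finite X] {r : ℕ} (hr : r.Prime) (f : X → X)
    (hf : f^[r] = id) (s : Set X) (hs : ∀ x ∈ s, f x ∈ s) :
    s.ncard ≡ {x ∈ s | f x = x}.ncard [MOD r] := by
  classical
  have : Fact r.Prime := ⟨hr⟩
  have := Fintype.ofFinite X
  let F : Function.End s := Set.MapsTo.restrict f s s hs
  have hF : F ^ r ^ 1 = 1 := by
    rw [pow_one]
    have h1 : F ^ r = (F : s → s)^[r] :=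
      hom_coe_pow (fun g : Function.End s ↦ (g : s → s)) rfl (fun g h ↦ rfl) F r
    rw [h1]
    funext x
    apply Subtype.ext
    have h2 : ∀ n (x : s), (((F : s → s)^[n] x : s) : X) = f^[n] x := by
      intro n
      induction n with
      | zero => intro x; rfl
      | succ n ih => intro x; rw [Function.iterate_succ_apply, ih, Function.iterate_succ_apply]; rfl
    rw [h2, hf]; rfl
  have h := Equiv.Perm.card_fixedPoints_modEq hF
  rw [← Nat.card_eq_fintype_card, ← Nat.card_eq_fintype_card] at h
  have e : Nat.card (Function.fixedPoints F) = {x ∈ s | f x = x}.ncard := by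
    rw [← Nat.card_coe_set_eq]
    refine Nat.card_congr ⟨fun x => ⟨x.1.1, x.1.2, congrArg Subtype.val x.2⟩,
      fun x => ⟨⟨x.1, x.2.1⟩, Subtype.ext x.2.2⟩, fun x => rfl, fun x => rfl⟩
  rw [e] at h
  exact h

theorem num_dichotomy {r t v : ℕ} (hr : 1 < r) (hv : v < (r + 1) ^ 2) (htv : t ∣ v)
    (ht : t ≡ 1 [MOD r]) (hv1 : v ≡ 1 [MOD r]) : t = 1 ∨ t = v := by
  obtain ⟨e, rfl⟩ := htv
  have he : e ≡ 1 [MOD r] := by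
    have : t * e ≡ 1 * e [MOD r] := ht.mul_right e
    rw [one_mul] at this
    exact this.symm.trans hv1
  have key : ∀ x, x ≡ 1 [MOD r] → x = 1 ∨ r + 1 ≤ x := by
    intro x hx
    have hx0 : x ≠ 0 := by
      rintro rfl
      have := (Nat.modEq_iff_dvd' (Nat.zero_le 1)).1 hx
      simp at this; omega
    obtain ⟨c, hc⟩ := (Nat.modEq_iff_dvd' (by omega : 1 ≤ x)).1 hx.symm
    rcases Nat.eq_zero_or_pos c with h | h
    · left; subst h; omega
    · right; have : r ≤ r * c := Nat.le_mul_of_pos_right r h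
      omega
  rcases key t ht with h | h
  · exact Or.inl h
  · rcases key e he with h' | h'
    · right; rw [h', mul_one]
    · exfalso
      have := Nat.mul_le_mul h h'
      nlinarith

theorem num_bound (h : ℕ) : 4 * h ^ 2 + 2 * h + 1 < 6 * 2 ^ h := by
  induction h with
  | zero => norm_num
  | succ n ih =>
    rcases Nat.lt_or_ge n 3 with h3 | h3
    · interval_cases n <;> norm_num
    · rw [show 2 ^ (n + 1) = 2 * 2 ^ n by ring]; nlinarith

theorem num_bound' (h : ℕ) (hh : 1 ≤ h) : 4 * h ^ 2 + 2 * h + 1 < 2 ^ (2 * h + 1) := by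
  induction h, hh using Nat.le_induction with
  | base => norm_num
  | succ n hn ih =>
    have : 2 ^ (2 * (n + 1) + 1) = 4 * 2 ^ (2 * n + 1) := by ring
    rw [this]; nlinarith

theorem six_le_card {H : Type*} [Group H] [Finite H] (hH : ∃ a b : H, a * b ≠ b * a) :
    6 ≤ Nat.card H := by
  by_contra hlt
  have hpos : 0 < Nat.card H := Nat.card_pos
  obtain ⟨a, b, hab⟩ := hH
  have hprime : ∀ p : ℕ, p.Prime → Nat.card H = p → False := by
    intro p hp hc
    have : Fact p.Prime := ⟨hp⟩
    have := isCyclic_of_prime_card hc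
    obtain ⟨g, hg⟩ := IsCyclic.exists_generator (α := H)
    obtain ⟨m, rfl⟩ := hg a
    obtain ⟨n, rfl⟩ := hg b
    exact hab (by rw [← zpow_add, ← zpow_add, add_comm])
  have h5 : Nat.card H ≤ 5 := by omega
  generalize hc : Nat.card H = c at *
  interval_cases c
  · have := (Nat.card_eq_one_iff_unique.1 hc).1
    exact hab (Subsingleton.elim _ _)
  · exact hprime 2 (by norm_num) rfl
  · exact hprime 3 (by norm_num) rfl
  · have : Fact (Nat.Prime 2) := ⟨by norm_num⟩
    have := IsPGroup.isMulCommutative_of_card_eq_prime_sq (p := 2) (G := H) (by rw [hc]; norm_num)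
    exact hab (this.is_comm.comm a b)
  · exact hprime 5 (by norm_num) rfl

/-- A finite group of small order with a fixed-point-free automorphism of prime order `r`
is a `p`-group. -/
theorem pgroup_of_fpf {H : Type*} [Group H] [Finite H] [Nontrivial H] {r : ℕ} (hr : r.Prime)
    (φ : MulAut H) (hφ : φ ^ r = 1) (hfix : ∀ x, φ x = x → x = 1)
    (hcard : Nat.card H < (r + 1) ^ 2) : ∃ p, p.Prime ∧ IsPGroup p H := by
  have hit : (φ : H → H)^[r] = id := by
    have h1 : ⇑(φ ^ r) = (φ : H → H)^[r] :=
      hom_coe_pow (fun g : MulAut H ↦ (g : H → H)) rfl (fun g h ↦ rfl) φ r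
    rw [← h1, hφ]; rfl
  have hsub : ∀ K : Subgroup H, (∀ x ∈ K, φ x ∈ K) → Nat.card K ≡ 1 [MOD r] := by
    intro K hK
    have h := ncard_modEq hr φ hit (K : Set H) hK
    have e : {x ∈ (K : Set H) | φ x = x} = {1} := by
      ext x; constructor
      · rintro ⟨_, h⟩; exact hfix x h
      · rintro rfl; exact ⟨K.one_mem, map_one φ⟩
    rw [e, Set.ncard_singleton] at h
    exact h
  have hH1 : Nat.card H ≡ 1 [MOD r] := by
    have := hsub ⊤ (fun _ _ => trivial)
    rwa [Subgroup.card_top] at this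
  have hne : Nat.card H ≠ 1 := by
    have := Finite.one_lt_card (α := H); omega
  obtain ⟨p, hp, hpd⟩ := Nat.exists_prime_and_dvd hne
  refine ⟨p, hp, ?_⟩
  have : Fact p.Prime := ⟨hp⟩
  have : Fact r.Prime := ⟨hr⟩
  -- number of Sylow subgroups
  have hnd : ¬ r ∣ Nat.card (Sylow p H) := by
    intro hd
    have Q : Sylow p H := default
    have h1 : r ∣ Nat.card H := hd.trans (Q.card_dvd_index.trans (Subgroup.index_dvd_card _))
    have h2 := (Nat.modEq_zero_iff_dvd.2 h1).symm.trans hH1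
    have := (Nat.modEq_iff_dvd' (Nat.zero_le 1)).1 h2
    exact hr.one_lt.ne' (Nat.dvd_one.1 this)
  have hitS : (fun Q : Sylow p H => φ • Q)^[r] = id := by
    rw [smul_iterate, hφ]; funext Q; exact one_smul _ _
  have h := ncard_modEq hr (fun Q : Sylow p H => φ • Q) hitS Set.univ (fun _ _ => trivial)
  rw [Set.ncard_univ] at h
  have hex : ∃ Q : Sylow p H, φ • Q = Q := by
    by_contra hno
    push Not at hno
    have e : {x ∈ (Set.univ : Set (Sylow p H)) | φ • x = x} = ∅ := by
      ext x; simp [hno x]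
    rw [e, Set.ncard_empty] at h
    exact hnd (Nat.modEq_zero_iff_dvd.1 h)
  obtain ⟨Q, hQ⟩ := hex
  have hQ1 := hsub Q.toSubgroup (by
    intro x hx
    have : φ • x ∈ φ • Q.toSubgroup := Subgroup.smul_mem_pointwise_smul _ _ _ hx
    rw [← Sylow.pointwise_smul_def, hQ] at this
    exact this)
  have hQd := Subgroup.card_subgroup_dvd_card Q.toSubgroup
  rcases num_dichotomy hr.one_lt hcard hQd hQ1 hH1 with h1 | h1
  · exfalso
    have := Q.dvd_card_of_dvd_card hpd
    rw [h1] at this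
    exact hp.one_lt.ne' (Nat.dvd_one.1 this)
  · obtain ⟨n, hn⟩ := (IsPGroup.iff_card (p := p)).1 Q.isPGroup'
    exact IsPGroup.of_card (h1 ▸ hn)

section Grp

variable {G : Type*} [Group G]

/-- Conjugate of a subgroup. -/
def cj (x : G) (T : Subgroup G) : Subgroup G := T.map (MulAut.conj x).toMonoidHom

theorem mem_cj {x y : G} {T : Subgroup G} : y ∈ cj x T ↔ x⁻¹ * y * x ∈ T := by
  unfold cj
  rw [Subgroup.mem_map]
  constructor
  · rintro ⟨t, ht, rfl⟩
    simpa [mul_assoc] using ht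
  · intro h
    exact ⟨_, h, by simp [mul_assoc]⟩

theorem cj_mem {x t : G} {T : Subgroup G} (ht : t ∈ T) : x * t * x⁻¹ ∈ cj x T := by
  rw [mem_cj]; simpa [mul_assoc] using ht

theorem cj_mul (x y : G) (T : Subgroup G) : cj (x * y) T = cj x (cj y T) := by
  ext z; simp [mem_cj, mul_assoc]

theorem cj_one (T : Subgroup G) : cj 1 T = T := by
  ext z; simp [mem_cj]

theorem cj_sup (x : G) (S T : Subgroup G) : cj x (S ⊔ T) = cj x S ⊔ cj x T :=
  Subgroup.map_sup _ _ _

theorem cj_bot (x : G) : cj x (⊥ : Subgroup G) = ⊥ := Subgroup.map_bot _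

theorem cj_mono (x : G) {S T : Subgroup G} (h : S ≤ T) : cj x S ≤ cj x T :=
  Subgroup.map_mono h

theorem cj_eq_bot {x : G} {T : Subgroup G} : cj x T = ⊥ ↔ T = ⊥ :=
  Subgroup.map_eq_bot_iff_of_injective _ (MulAut.conj x).injective

theorem cj_inv_cj (x : G) (T : Subgroup G) : cj x⁻¹ (cj x T) = T := by
  rw [← cj_mul, inv_mul_cancel, cj_one]

theorem cj_cj_inv (x : G) (T : Subgroup G) : cj x (cj x⁻¹ T) = T := by
  rw [← cj_mul, mul_inv_cancel, cj_one]

theorem cj_normal (x : G) {N : Subgroup G} (hN : N.Normal) : cj x N = N := by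
  ext z; rw [mem_cj]; exact hN.mem_comm_iff.trans (by simp)

theorem cj_eq_of_le [Finite G] {x : G} {T : Subgroup G} (h : cj x T ≤ T) : cj x T = T := by
  apply Subgroup.eq_of_le_of_card_ge h
  exact (Nat.card_congr (T.equivMapOfInjective _ (MulAut.conj x).injective).toEquiv).le

theorem cj_pow [Finite G] {x : G} {T : Subgroup G} (h : cj x T = T) (n : ℕ) :
    cj (x ^ n) T = T := by
  induction n with
  | zero => rw [pow_zero, cj_one]
  | succ n ih => rw [pow_succ, cj_mul, h, ih]

theorem cent_iff {A B : Subgroup G} : A ≤ Subgroup.centralizer (B : Set G) ↔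
    ∀ a ∈ A, ∀ b ∈ B, a * b = b * a := by
  constructor
  · intro h a ha b hb
    exact (Subgroup.mem_centralizer_iff.1 (h ha) b hb).symm
  · intro h a ha
    exact Subgroup.mem_centralizer_iff.2 fun b hb => (h a ha b hb).symm

theorem mem_sup_cent {A B : Subgroup G} (h : A ≤ Subgroup.centralizer (B : Set G)) {x : G}
    (hx : x ∈ A ⊔ B) : ∃ a ∈ A, ∃ b ∈ B, x = a * b := by
  rw [cent_iff] at h
  let K : Subgroup G :=
    { carrier := {x | ∃ a ∈ A, ∃ b ∈ B, x = a * b}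
      one_mem' := ⟨1, A.one_mem, 1, B.one_mem, by simp⟩
      mul_mem' := by
        rintro _ _ ⟨a, ha, b, hb, rfl⟩ ⟨c, hc, d, hd, rfl⟩
        refine ⟨a * c, A.mul_mem ha hc, b * d, B.mul_mem hb hd, ?_⟩
        have := h c hc b hb
        calc a * b * (c * d) = a * (b * c) * d := by group
          _ = a * (c * b) * d := by rw [this]
          _ = _ := by group
      inv_mem' := by
        rintro _ ⟨a, ha, b, hb, rfl⟩
        refine ⟨a⁻¹, A.inv_mem ha, b⁻¹, B.inv_mem hb, ?_⟩
        rw [← mul_inv_rev, ← h a ha b hb] }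
  have hK : A ⊔ B ≤ K := sup_le (fun a ha => ⟨a, ha, 1, B.one_mem, by simp⟩)
    (fun b hb => ⟨1, A.one_mem, b, hb, by simp⟩)
  exact hK hx

variable {P : Type*} [MulAction G P]

/-- The subgroup `M` is transitive. -/
def Trans (P : Type*) [MulAction G P] (M : Subgroup G) : Prop := ∀ x y : P, ∃ m ∈ M, m • x = y

theorem trans_of_orbit {M : Subgroup G} {α : P} (h : ∀ y : P, ∃ m ∈ M, m • α = y) :
    Trans P M := by
  intro x y
  obtain ⟨a, ha, rfl⟩ := h x
  obtain ⟨b, hb, rfl⟩ := h y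
  exact ⟨b * a⁻¹, M.mul_mem hb (M.inv_mem ha), by simp [mul_smul]⟩

theorem trans_cj {M : Subgroup G} (h : Trans P M) (x : G) : Trans P (cj x M) := by
  intro y z
  obtain ⟨m, hm, e⟩ := h (x⁻¹ • y) (x⁻¹ • z)
  refine ⟨x * m * x⁻¹, cj_mem hm, ?_⟩
  rw [mul_smul, mul_smul, e, smul_inv_smul]

theorem trans_mono {M N : Subgroup G} (h : Trans P M) (hMN : M ≤ N) : Trans P N := by
  intro y z
  obtain ⟨m, hm, e⟩ := h y z
  exact ⟨m, hMN hm, e⟩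

theorem semireg [FaithfulSMul G P] {A B : Subgroup G}
    (h : A ≤ Subgroup.centralizer (B : Set G)) (hB : Trans P B) {a : G} (ha : a ∈ A) {x : P}
    (hx : a • x = x) : a = 1 := by
  rw [cent_iff] at h
  apply FaithfulSMul.eq_of_smul_eq_smul (α := P)
  intro y
  obtain ⟨b, hb, rfl⟩ := hB x y
  rw [← mul_smul, h a ha b hb, mul_smul, hx, one_smul]

/-- Orbit of a point. -/
def orb (H : Subgroup G) (α : P) : Set P := {y | ∃ m ∈ H, m • α = y}

theorem orb_eq (H : Subgroup G) (α : P) : orb H α = MulAction.orbit H α := by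
  ext y; constructor
  · rintro ⟨m, hm, rfl⟩; exact ⟨⟨m, hm⟩, rfl⟩
  · rintro ⟨m, rfl⟩; exact ⟨m.1, m.2, rfl⟩

theorem orb_semireg {H : Subgroup G} {α : P} (h : ∀ a ∈ H, a • α = α → a = 1) :
    (orb H α).ncard = Nat.card H := by
  rw [← Nat.card_coe_set_eq]
  symm
  refine Nat.card_congr (Equiv.ofBijective (fun m : H => ⟨m.1 • α, m.1, m.2, rfl⟩) ⟨?_, ?_⟩)
  · intro a b hab
    have : a.1 • α = b.1 • α := congrArg Subtype.val hab
    have h2 : (b.1⁻¹ * a.1) • α = α := by rw [mul_smul, this, inv_smul_smul]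
    have := h _ (H.mul_mem (H.inv_mem b.2) a.2) h2
    exact Subtype.ext (inv_mul_eq_one.1 this).symm
  · rintro ⟨y, m, hm, rfl⟩
    exact ⟨⟨m, hm⟩, rfl⟩

/-- Standing hypotheses: an element `g` of prime order `r` with a unique fixed point. -/
structure Ctx (α : P) (g : G) (r : ℕ) : Prop where
  hr : r.Prime
  gr : g ^ r = 1
  fix : ∀ β : P, g • β = β ↔ β = α
  card : Nat.card P < (r + 1) ^ 2

variable [Finite P]

theorem Ctx.set_mod {α : P} {g : G} {r : ℕ} (C : Ctx α g r) {s : Set P} (hα : α ∈ s)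
    (hs : ∀ x ∈ s, g • x ∈ s) : s.ncard ≡ 1 [MOD r] := by
  have h := ncard_modEq C.hr (fun x : P => g • x)
    (by rw [smul_iterate, C.gr]; funext x; exact one_smul _ _) s hs
  have e : {x ∈ s | g • x = x} = {α} := by
    ext x; constructor
    · rintro ⟨_, h⟩; exact (C.fix x).1 h
    · rintro rfl; exact ⟨hα, (C.fix _).2 rfl⟩
  rw [e, Set.ncard_singleton] at h
  exact h

theorem Ctx.block {α : P} {g : G} {r : ℕ} (C : Ctx α g r) {s : Set P} (hα : α ∈ s)
    (hs : ∀ x ∈ s, g • x ∈ s) (hd : s.ncard ∣ Nat.card P) : s = {α} ∨ s = Set.univ := by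
  have h1 := C.set_mod hα hs
  have h2 := C.set_mod (Set.mem_univ α) (fun _ _ => trivial)
  rw [Set.ncard_univ] at h2
  rcases num_dichotomy C.hr.one_lt C.card hd h1 h2 with h | h
  · left
    obtain ⟨y, rfl⟩ := Set.ncard_eq_one.1 h
    rw [Set.mem_singleton_iff.1 hα]
  · right
    rw [← Set.ncard_univ] at h
    exact Set.eq_of_subset_of_ncard_le (Set.subset_univ s) h.ge

theorem Ctx.prim {α : P} {g : G} {r : ℕ} (C : Ctx α g r) [MulAction.IsPretransitive G P]
    (s : Set P) (hs : MulAction.IsBlock G s) : s.Subsingleton ∨ s = Set.univ := by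
  rcases s.eq_empty_or_nonempty with rfl | ⟨β, hβ⟩
  · left; exact Set.subsingleton_empty
  obtain ⟨x, hx⟩ := MulAction.exists_smul_eq G β α
  have hB := hs.translate x
  have hα : α ∈ x • s := by rw [← hx]; exact Set.smul_mem_smul_set hβ
  have hg : g • (x • s) = x • s := by
    apply hB.smul_eq_of_nonempty
    exact ⟨α, ⟨α, hα, (C.fix α).2 rfl⟩, hα⟩
  have := C.block hα (by
    intro y hy; rw [← hg]; exact Set.smul_mem_smul_set hy) (hB.ncard_dvd_card ⟨α, hα⟩)
  have hs' : s = x⁻¹ • (x • s) := by simp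
  rcases this with h | h
  · left; rw [hs', h]; simp
  · right; rw [hs', h]; simp

theorem Ctx.trans [FaithfulSMul G P] {α : P} {g : G} {r : ℕ} (C : Ctx α g r)
    {M H : Subgroup G} (hHM : H ≤ M) (hM : Trans P M) (hn : ∀ m ∈ M, cj m H ≤ H)
    (hg : cj g H ≤ H) (hne : H ≠ ⊥) : Trans P H := by
  have : MulAction.IsPretransitive M P := ⟨fun x y => by
    obtain ⟨m, hm, e⟩ := hM x y
    exact ⟨⟨m, hm⟩, e⟩⟩
  have : (H.subgroupOf M).Normal := ⟨by
    intro n hn' m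
    rw [Subgroup.mem_subgroupOf] at hn' ⊢
    exact hn m m.2 (cj_mem hn')⟩
  have hB : MulAction.IsBlock M (MulAction.orbit (H.subgroupOf M) α) :=
    MulAction.IsBlock.orbit_of_normal α
  have ho : MulAction.orbit (H.subgroupOf M) α = orb H α := by
    ext y; constructor
    · rintro ⟨m, rfl⟩; exact ⟨m.1.1, m.2, rfl⟩
    · rintro ⟨m, hm, rfl⟩; exact ⟨⟨⟨m, hHM hm⟩, hm⟩, rfl⟩
  rw [ho] at hB
  have hα : α ∈ orb H α := ⟨1, H.one_mem, one_smul _ _⟩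
  have gα : g • α = α := (C.fix α).2 rfl
  have gα' : g⁻¹ • α = α := inv_smul_eq_iff.2 gα.symm
  rcases C.block hα (by
    rintro y ⟨m, hm, rfl⟩
    refine ⟨g * m * g⁻¹, hg (cj_mem hm), ?_⟩
    rw [mul_smul, mul_smul, gα']) (hB.ncard_dvd_card ⟨α, hα⟩) with h | h
  · exfalso
    apply hne
    rw [eq_bot_iff]
    intro x hx
    rw [Subgroup.mem_bot]
    apply FaithfulSMul.eq_of_smul_eq_smul (α := P)
    intro y
    obtain ⟨m, hm, rfl⟩ := hM α y
    have h1 : m⁻¹ * x * m ∈ H := by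
      have := hn _ (M.inv_mem hm) (cj_mem (x := m⁻¹) hx)
      simpa using this
    have h2 : (m⁻¹ * x * m) • α ∈ orb H α := ⟨_, h1, rfl⟩
    rw [h, Set.mem_singleton_iff, mul_smul, mul_smul, inv_smul_eq_iff] at h2
    rw [h2, one_smul]
  · apply trans_of_orbit (α := α)
    intro y
    have : y ∈ orb H α := h ▸ Set.mem_univ y
    exact this

theorem Ctx.regular [Finite G] [FaithfulSMul G P] {α : P} {g : G} {r : ℕ} (C : Ctx α g r)
    {H : Subgroup G} (hs : ∀ a ∈ H, a • α = α → a = 1)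
    (hg : cj g H ≤ H) (hne : H ≠ ⊥) : ∃ p, p.Prime ∧ IsPGroup p H := by
  have : Nontrivial H := (Subgroup.nontrivial_iff_ne_bot H).2 hne
  have gα : g • α = α := (C.fix α).2 rfl
  let f : H →* H := 
    { toFun := fun h => ⟨g * h * g⁻¹, hg (cj_mem h.2)⟩
      map_one' := by simp
      map_mul' := by intro a b; apply Subtype.ext; simp [mul_assoc] }
  have hinj : Function.Injective f := by
    intro a b hab
    have : g * a.1 * g⁻¹ = g * b.1 * g⁻¹ := congrArg Subtype.val hab
    exact Subtype.ext (by simpa using this)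
  let φ : MulAut H := MulEquiv.ofBijective f (Finite.injective_iff_bijective.1 hinj)
  have hval : ∀ x, ((φ x : H) : G) = g * x * g⁻¹ := fun x => rfl
  have hpow : ∀ n x, (((φ ^ n) x : H) : G) = g ^ n * x * (g ^ n)⁻¹ := by
    intro n
    induction n with
    | zero => intro x; simp
    | succ n ih => intro x; rw [pow_succ, MulAut.mul_apply, ih, hval]; simp [pow_succ, mul_assoc]
  apply pgroup_of_fpf C.hr φ
  · ext x; rw [hpow, C.gr]; simp
  · intro x hx
    have h1 : g * x.1 * g⁻¹ = x.1 := congrArg Subtype.val hx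
    have h2 : g * x.1 = x.1 * g := mul_inv_eq_iff_eq_mul.1 h1
    have h3 : x.1 • α = α := by
      apply (C.fix _).1
      rw [← mul_smul, h2, mul_smul, gα]
    exact Subtype.ext (hs x.1 x.2 h3)
  · refine lt_of_le_of_lt ?_ C.card
    rw [← orb_semireg hs, ← Set.ncard_univ]
    exact Set.ncard_le_ncard (Set.subset_univ _)

/-- Join of the conjugates of `T` by `g ^ a, …, g ^ (a + n - 1)`. -/
def Tw (g : G) (T : Subgroup G) (a : ℕ) : ℕ → Subgroup G
  | 0 => ⊥
  | n + 1 => Tw g T a n ⊔ cj (g ^ (a + n)) T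

theorem Tw_cj (g : G) (T : Subgroup G) (a b n : ℕ) :
    cj (g ^ b) (Tw g T a n) = Tw g T (a + b) n := by
  induction n with
  | zero => exact cj_bot _
  | succ n ih =>
    change cj (g ^ b) (Tw g T a n ⊔ cj (g ^ (a + n)) T) = Tw g T (a + b) n ⊔ cj (g ^ (a + b + n)) T
    rw [cj_sup, ih, ← cj_mul, ← pow_add, show b + (a + n) = a + b + n by ring]

theorem Tw_shift (g : G) (T : Subgroup G) (n : ℕ) : Tw g T 1 n ≤ Tw g T 0 (n + 1) := by
  induction n with
  | zero => exact bot_le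
  | succ n ih =>
    refine sup_le (ih.trans le_sup_left) ?_
    rw [show 1 + n = 0 + (n + 1) by ring]
    exact le_sup_right

theorem Tw_mono (g : G) (T : Subgroup G) (a : ℕ) {m n : ℕ} (h : m ≤ n) :
    Tw g T a m ≤ Tw g T a n := by
  induction h with
  | refl => exact le_rfl
  | step _ ih => exact ih.trans le_sup_left

theorem Tw_le {g : G} {T N : Subgroup G} (a n : ℕ) (h : ∀ i, cj (g ^ i) T ≤ N) :
    Tw g T a n ≤ N := by
  induction n with
  | zero => exact bot_le
  | succ n ih => exact sup_le ih (h _)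

theorem Tw_cent {g : G} {T K : Subgroup G} {a n : ℕ}
    (h : ∀ i < n, cj (g ^ (a + i)) T ≤ Subgroup.centralizer (K : Set G)) :
    Tw g T a n ≤ Subgroup.centralizer (K : Set G) := by
  induction n with
  | zero => exact bot_le
  | succ n ih => exact sup_le (ih fun i hi => h i (by omega)) (h n (by omega))

theorem tower [Finite G] [FaithfulSMul G P] {α : P} {g : G} {r h : ℕ} (C : Ctx α g r)
    (hrh : r = 2 * h + 1) (hh : 1 ≤ h) (hv : Nat.card P ≤ 4 * h ^ 2 + 2 * h + 1)
    {N T : Subgroup G} (hN : N.Normal) (htr : Trans P N) (hTN : T ≤ N)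
    (hnT : ∀ n ∈ N, cj n T ≤ T) (hna : ¬ ∀ a ∈ T, ∀ b ∈ T, a * b = b * a)
    (hc : ∀ i j, i < r → j < r → i ≠ j →
      cj (g ^ i) T ≤ Subgroup.centralizer (cj (g ^ j) T : Set G)) : False := by
  have gα : g • α = α := (C.fix α).2 rfl
  have gα' : g⁻¹ • α = α := inv_smul_eq_iff.2 gα.symm
  have hTne : T ≠ ⊥ := by
    rintro rfl
    apply hna
    intro a ha b hb
    rw [Subgroup.mem_bot] at ha hb
    rw [ha, hb]
  have hcN : ∀ i, cj (g ^ i) T ≤ N := fun i => by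
    rw [← cj_normal (g ^ i) hN]; exact cj_mono _ hTN
  have hnTi : ∀ i, ∀ n ∈ N, cj n (cj (g ^ i) T) ≤ cj (g ^ i) T := by
    intro i n hn
    have h1 : (g ^ i)⁻¹ * n * (g ^ i) ∈ N := by
      have := hN.conj_mem n hn (g ^ i)⁻¹
      simpa using this
    have h2 := cj_mono (g ^ i) (hnT _ h1)
    rw [← cj_mul] at h2 ⊢
    rwa [show g ^ i * ((g ^ i)⁻¹ * n * g ^ i) = n * g ^ i by group] at h2
  have hfin : ∀ s : Set P, s.Finite := fun s => s.toFinite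
  -- commuting of successive pieces
  have hcomm : ∀ n < r, Tw g T 0 n ≤ Subgroup.centralizer (cj (g ^ n) T : Set G) := by
    intro n hn
    apply Tw_cent
    intro i hi
    exact hc _ _ (by omega) hn (by omega)
  -- whole tower is transitive
  have hTr0 : Tw g T 0 1 = T := by
    change ⊥ ⊔ cj (g ^ (0 + 0)) T = T
    rw [bot_sup_eq]; simp [cj_one]
  have htop : Trans P (Tw g T 0 r) := by
    apply C.trans (M := N) (Tw_le _ _ hcN) htr
    · intro n hn
      generalize r = m
      induction m with
      | zero => exact (cj_bot n).le
      | succ m ih =>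
        change cj n (Tw g T 0 m ⊔ cj (g ^ (0 + m)) T) ≤ Tw g T 0 m ⊔ cj (g ^ (0 + m)) T
        rw [cj_sup]
        exact sup_le_sup ih (hnTi _ n hn)
    · have h1 := Tw_cj g T 0 1 r
      rw [pow_one, zero_add] at h1
      rw [h1]
      refine (Tw_shift g T r).trans ?_
      refine sup_le le_rfl ?_
      rw [zero_add, C.gr, cj_one]
      calc T = Tw g T 0 1 := hTr0.symm
        _ ≤ _ := Tw_mono g T 0 (by omega)
    · intro hb
      apply hTne
      rw [eq_bot_iff, ← hb]
      calc T = Tw g T 0 1 := hTr0.symm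
        _ ≤ _ := Tw_mono g T 0 (by omega)
  -- stationarity implies transitivity
  have hbadtr : ∀ n < r, (∀ t ∈ cj (g ^ n) T, t • α ∈ orb (Tw g T 0 n) α) →
      Trans P (Tw g T 0 n) := by
    intro n hn hbad
    have hbad' : ∀ m, n ≤ m → (∀ t ∈ cj (g ^ m) T, t • α ∈ orb (Tw g T 0 m) α) := by
      intro m hm
      induction m, hm using Nat.le_induction with
      | base => exact hbad
      | succ m hm ih =>
        intro t ht
        have h1 : g⁻¹ * t * g ∈ cj (g ^ m) T := by
          rw [pow_succ', cj_mul, mem_cj] at ht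
          exact ht
        obtain ⟨e, he, hee⟩ := ih _ h1
        rw [mul_smul, mul_smul, gα] at hee
        have h2 : g * e * g⁻¹ ∈ Tw g T 1 m := by
          have h3 := Tw_cj g T 0 1 m
          rw [pow_one, zero_add] at h3
          rw [← h3]; exact cj_mem he
        refine ⟨_, Tw_shift g T m h2, ?_⟩
        rw [mul_smul, mul_smul, gα', hee, smul_inv_smul]
    have hsub : ∀ m, n ≤ m → m ≤ r → orb (Tw g T 0 m) α ⊆ orb (Tw g T 0 n) α := by
      intro m hm
      induction m, hm using Nat.le_induction with
      | base => intro _; exact subset_rfl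
      | succ m hm ih =>
        intro hmr
        refine Set.Subset.trans ?_ (ih (by omega))
        rintro y ⟨x, hx, rfl⟩
        have hx' : x ∈ Tw g T 0 m ⊔ cj (g ^ m) T := by
          have : x ∈ Tw g T 0 m ⊔ cj (g ^ (0 + m)) T := hx
          rwa [zero_add] at this
        obtain ⟨a, ha, b, hb, rfl⟩ := mem_sup_cent (hcomm m (by omega)) hx'
        obtain ⟨e, he, hee⟩ := hbad' m hm b hb
        exact ⟨a * e, Subgroup.mul_mem _ ha he, by rw [mul_smul, mul_smul, hee]⟩
    apply trans_of_orbit (α := α)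
    intro y
    exact hsub r hn.le le_rfl (htop α y)
  have hgrow : ∀ n < r, ¬ Trans P (Tw g T 0 n) →
      2 * (orb (Tw g T 0 n) α).ncard ≤ (orb (Tw g T 0 (n + 1)) α).ncard := by
    intro n hn hnt
    have : ∃ t ∈ cj (g ^ n) T, t • α ∉ orb (Tw g T 0 n) α := by
      by_contra hcon
      push Not at hcon
      exact hnt (hbadtr n hn hcon)
    obtain ⟨t, ht, hta⟩ := this
    have hcm := cent_iff.1 (hcomm n hn)
    have ht' : t ∈ Tw g T 0 (n + 1) := by
      have : t ∈ Tw g T 0 n ⊔ cj (g ^ (0 + n)) T := by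
        rw [zero_add]; exact Subgroup.mem_sup_right ht
      exact this
    have hle : Tw g T 0 n ≤ Tw g T 0 (n + 1) := le_sup_left
    have hdis : Disjoint (orb (Tw g T 0 n) α) (t • orb (Tw g T 0 n) α) := by
      rw [Set.disjoint_left]
      rintro y ⟨a, ha, rfl⟩ ⟨z, ⟨b, hb, rfl⟩, hz⟩
      apply hta
      refine ⟨b⁻¹ * a, Subgroup.mul_mem _ (Subgroup.inv_mem _ hb) ha, ?_⟩
      have hz' : t • b • α = a • α := hz
      rw [mul_smul, ← hz', ← mul_smul t, ← hcm b hb t ht, mul_smul, inv_smul_smul]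
    calc 2 * (orb (Tw g T 0 n) α).ncard
        = (orb (Tw g T 0 n) α).ncard + (t • orb (Tw g T 0 n) α).ncard := by
          rw [two_mul]; congr 1
          exact (Set.ncard_image_of_injective _ (MulAction.injective t)).symm
      _ = (orb (Tw g T 0 n) α ∪ t • orb (Tw g T 0 n) α).ncard :=
          (Set.ncard_union_eq hdis (hfin _) (hfin _)).symm
      _ ≤ _ := by
          apply Set.ncard_le_ncard _ (hfin _)
          apply Set.union_subset
          · rintro y ⟨a, ha, rfl⟩; exact ⟨a, hle ha, rfl⟩
          · rintro y ⟨z, ⟨a, ha, rfl⟩, rfl⟩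
            exact ⟨t * a, Subgroup.mul_mem _ ht' (hle ha), mul_smul _ _ _⟩
  have hlev : ∀ s : Set P, s.ncard ≤ 4 * h ^ 2 + 2 * h + 1 := fun s =>
    (Set.ncard_le_ncard (Set.subset_univ s)).trans (by rw [Set.ncard_univ]; exact hv)
  by_cases hr1 : Trans P (Tw g T 0 (r - 1))
  · -- `T` is semiregular
    have htr1 : Trans P (Tw g T 1 (r - 1)) := by
      have h3 := Tw_cj g T 0 1 (r - 1)
      rw [zero_add] at h3
      rw [← h3]; exact trans_cj hr1 _
    have hTc : T ≤ Subgroup.centralizer (Tw g T 1 (r - 1) : Set G) := by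
      rw [Subgroup.le_centralizer_iff]
      apply Tw_cent
      intro i hi
      have := hc (1 + i) 0 (by omega) (by omega) (by omega)
      rwa [pow_zero, cj_one] at this
    have hTsr : ∀ a ∈ T, a • α = α → a = 1 := fun a ha hx => semireg hTc htr1 ha hx
    have h6 : 6 ≤ Nat.card T := by
      apply six_le_card
      by_contra hcon
      push Not at hcon
      exact hna fun a ha b hb => congrArg Subtype.val (hcon ⟨a, ha⟩ ⟨b, hb⟩)
    by_cases hh1 : Trans P (Tw g T 0 h)
    · have hcc : Tw g T h (h + 1) ≤ Subgroup.centralizer (Tw g T 0 h : Set G) := by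
        apply Tw_cent
        intro i hi
        rw [Subgroup.le_centralizer_iff]
        apply Tw_cent
        intro j hj
        exact hc _ _ (by omega) (by omega) (by omega)
      have h1 := orb_semireg (α := α) (fun a ha hx => semireg hcc hh1 ha hx)
      have h2 : ∀ n, n ≤ h → 6 * 2 ^ n ≤ Nat.card (Tw g T h (n + 1)) := by
        intro n
        induction n with
        | zero =>
          intro _
          have : Nat.card (Tw g T h 1) = Nat.card T := by
            have e : Tw g T h 1 = cj (g ^ h) T := by
              change ⊥ ⊔ cj (g ^ (h + 0)) T = _
              rw [bot_sup_eq, add_zero]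
            rw [e]
            exact (Nat.card_congr
              (T.equivMapOfInjective _ (MulAut.conj (g ^ h)).injective).toEquiv).symm
          rw [this]; simpa using h6
        | succ n ih =>
          intro hn
          have ih := ih (by omega)
          have hle : Tw g T h (n + 1) ≤ Tw g T h (n + 2) := le_sup_left
          have hne : Tw g T h (n + 1) ≠ Tw g T h (n + 2) := by
            intro heq
            have h3 : cj (g ^ (h + (n + 1))) T ≤ Tw g T h (n + 1) := by
              rw [heq]; exact le_sup_right
            have h4 : Tw g T h (n + 1) ≤
                Subgroup.centralizer (cj (g ^ (h + (n + 1))) T : Set G) := by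
              apply Tw_cent
              intro i hi
              exact hc _ _ (by omega) (by omega) (by omega)
            have h5 := cent_iff.1 (h3.trans h4)
            apply hna
            intro a ha b hb
            have := h5 _ (cj_mem ha) _ (cj_mem hb)
            simp only [mul_assoc, inv_mul_cancel_left, mul_right_inj] at this
            simpa only [← mul_assoc, mul_left_inj] using this
          obtain ⟨c, hcd⟩ := Subgroup.card_dvd_of_le hle
          have hpos : 0 < Nat.card (Tw g T h (n + 2)) := Nat.card_pos
          have hc2 : 2 ≤ c := by
            by_contra hlt
            have : c = 0 ∨ c = 1 := by omega
            rcases this with rfl | rfl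
            · omega
            · exact hne (Subgroup.eq_of_le_of_card_ge hle (by omega))
          rw [pow_succ]
          change _ ≤ Nat.card (Tw g T h (n + 2))
          rw [hcd]
          nlinarith
      have h3 := h2 h le_rfl
      have h4 := hlev (orb (Tw g T h (h + 1)) α)
      have := num_bound h
      omega
    · have h2 : ∀ n, n ≤ h → 6 * 2 ^ n ≤ (orb (Tw g T 0 (n + 1)) α).ncard := by
        intro n
        induction n with
        | zero =>
          intro _
          rw [zero_add, hTr0, orb_semireg hTsr]; simpa using h6
        | succ n ih =>
          intro hn
          have ih := ih (by omega)
          have := hgrow (n + 1) (by omega) fun ht => hh1 (trans_mono ht (Tw_mono g T 0 hn))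
          rw [pow_succ]
          omega
      have h3 := h2 h le_rfl
      have h4 := hlev (orb (Tw g T 0 (h + 1)) α)
      have := num_bound h
      omega
  · have h2 : ∀ n, n ≤ r → 2 ^ n ≤ (orb (Tw g T 0 n) α).ncard := by
      intro n
      induction n with
      | zero =>
        intro _
        rw [pow_zero]
        exact (Set.ncard_pos (hfin _)).2 ⟨α, 1, Subgroup.one_mem _, one_smul _ _⟩
      | succ n ih =>
        intro hn
        have ih := ih (by omega)
        have := hgrow n (by omega) fun ht => hr1 (trans_mono ht (Tw_mono g T 0 (by omega)))
        rw [pow_succ]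
        omega
    have h3 := h2 r le_rfl
    have h4 := hlev (orb (Tw g T 0 r) α)
    have h5 := num_bound' h hh
    rw [← hrh] at h5
    omega

/-- The centre of a subgroup as a subgroup of the ambient group. -/
def zen (H : Subgroup G) : Subgroup G := H ⊓ Subgroup.centralizer (H : Set G)

theorem zen_cj [Finite G] {H : Subgroup G} {n : G} (h : cj n H ≤ H) : cj n (zen H) ≤ zen H := by
  intro y hy
  rw [mem_cj] at hy
  have he := cj_eq_of_le h
  obtain ⟨h1, h2⟩ := hy
  have hy' : y ∈ H := h (mem_cj.2 h1)
  refine ⟨hy', Subgroup.mem_centralizer_iff.2 fun x hx => ?_⟩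
  have hx' : n⁻¹ * x * n ∈ H := by
    have hx1 : x ∈ H := hx
    rw [← he, mem_cj] at hx1
    exact hx1
  have := Subgroup.mem_centralizer_iff.1 h2 _ hx'
  have e1 : n⁻¹ * x * n * (n⁻¹ * y * n) = n⁻¹ * (x * y) * n := by group
  have e2 : n⁻¹ * y * n * (n⁻¹ * x * n) = n⁻¹ * (y * x) * n := by group
  rw [e1, e2] at this
  simpa using this

theorem zen_comm {H : Subgroup G} (h : zen H = H) : ∀ a ∈ H, ∀ b ∈ H, a * b = b * a := by
  apply cent_iff.1
  have : zen H ≤ Subgroup.centralizer (H : Set G) := inf_le_right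
  rwa [h] at this

theorem zen_ne_bot [Finite G] {H : Subgroup G} (hne : H ≠ ⊥) {p : ℕ} (hp : p.Prime)
    (h : IsPGroup p H) : zen H ≠ ⊥ := by
  have : Fact p.Prime := ⟨hp⟩
  have : Nontrivial H := (Subgroup.nontrivial_iff_ne_bot H).2 hne
  have := h.center_nontrivial
  obtain ⟨z, hz⟩ := exists_ne (1 : Subgroup.center H)
  intro hb
  apply hz
  have : (z.1 : G) ∈ zen H := ⟨z.1.2, Subgroup.mem_centralizer_iff.2 fun x hx =>
    congrArg Subtype.val (Subgroup.mem_center_iff.1 z.2 ⟨x, hx⟩)⟩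
  rw [hb, Subgroup.mem_bot] at this
  exact Subtype.ext (Subtype.ext this)

theorem normal_of_cj {H : Subgroup G} (h : ∀ x, cj x H ≤ H) : H.Normal :=
  ⟨fun _ hn x => h x (cj_mem hn)⟩

theorem dichotomy [Finite G] [FaithfulSMul G P] [Nontrivial P] {α : P} {g : G} {r h : ℕ}
    (C : Ctx α g r) (hG : MulAction.IsPretransitive G P)
    (hrh : r = 2 * h + 1) (hh : 1 ≤ h) (hv : Nat.card P ≤ 4 * h ^ 2 + 2 * h + 1) :
    ((∃ N : Subgroup G, N.Normal ∧
        (∀ a ∈ N, ∀ b ∈ N, a * b = b * a) ∧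
        (∃ p : ℕ, p.Prime ∧ ∀ g ∈ N, g ≠ 1 → orderOf g = p) ∧
        (∀ x y : P, ∃ g ∈ N, g • x = y) ∧
        (∀ g ∈ N, ∀ x : P, g • x = x → g = 1)) ∨
      (∃ X : Subgroup G, X.Normal ∧ IsSimpleGroup X ∧
        (∃ a b : X, a * b ≠ b * a) ∧
        Subgroup.centralizer (X : Set G) = ⊥)) := by
  have htop : Trans P (⊤ : Subgroup G) := fun x y => by
    obtain ⟨m, hm⟩ := MulAction.exists_smul_eq G x y
    exact ⟨m, trivial, hm⟩
  have htopne : (⊤ : Subgroup G) ≠ ⊥ := by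
    intro hb
    obtain ⟨x, y, hxy⟩ := exists_pair_ne P
    obtain ⟨m, hm, e⟩ := htop x y
    rw [hb, Subgroup.mem_bot] at hm
    rw [hm, one_smul] at e
    exact hxy e
  obtain ⟨N, ⟨hN, hNne⟩, hNmin⟩ := Set.Finite.exists_minimal
    (Set.toFinite {N : Subgroup G | N.Normal ∧ N ≠ ⊥}) ⟨⊤, inferInstance, htopne⟩
  have hmin : ∀ M : Subgroup G, M.Normal → M ≠ ⊥ → M ≤ N → M = N :=
    fun M h1 h2 h3 => le_antisymm h3 (hNmin ⟨h1, h2⟩ h3)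
  have hnormtr : ∀ M : Subgroup G, M.Normal → M ≠ ⊥ → Trans P M := fun M h1 h2 =>
    C.trans le_top htop (fun m _ => (cj_normal m h1).le) (cj_normal g h1).le h2
  have hNtr := hnormtr N hN hNne
  by_cases hab : ∀ a ∈ N, ∀ b ∈ N, a * b = b * a
  · left
    have hcard : Nat.card N ≠ 1 := fun h1 => hNne (Subgroup.card_eq_one.1 h1)
    obtain ⟨p, hp, hpd⟩ := Nat.exists_prime_and_dvd hcard
    have : Fact p.Prime := ⟨hp⟩
    refine ⟨N, hN, hab, ⟨p, hp, ?_⟩, hNtr, fun x hx y hxy => semireg (cent_iff.2 hab) hNtr hx hxy⟩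
    let K : Subgroup G :=
      { carrier := {x | x ∈ N ∧ x ^ p = 1}
        one_mem' := ⟨N.one_mem, one_pow p⟩
        mul_mem' := by
          rintro a b ⟨ha, ha'⟩ ⟨hb, hb'⟩
          refine ⟨N.mul_mem ha hb, ?_⟩
          rw [Commute.mul_pow (hab a ha b hb), ha', hb', one_mul]
        inv_mem' := by
          rintro a ⟨ha, ha'⟩
          exact ⟨N.inv_mem ha, by rw [inv_pow, ha', inv_one]⟩ }
    have hK : K = N := by
      apply hmin
      · refine ⟨?_⟩
        rintro n ⟨hn, hn'⟩ x
        exact ⟨hN.conj_mem n hn x, by rw [conj_pow, hn']; simp⟩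
      · obtain ⟨x, hx⟩ := exists_prime_orderOf_dvd_card' p hpd
        intro hb
        have h1 : x.1 ∈ K := ⟨x.2, by
          have := pow_orderOf_eq_one x
          rw [hx] at this
          exact congrArg Subtype.val this⟩
        rw [hb, Subgroup.mem_bot] at h1
        have h2 : x = 1 := Subtype.ext h1
        rw [h2, orderOf_one] at hx
        exact hp.one_lt.ne hx
      · rintro x ⟨hx, _⟩; exact hx
    intro x hx hx1
    rw [← hK] at hx
    exact orderOf_eq_prime hx.2 hx1
  · right
    -- the centralizer is trivial
    have hcent : Subgroup.centralizer (N : Set G) = ⊥ := by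
      by_contra hne
      have hCtr := hnormtr _ inferInstance hne
      have hNC : N ≤ Subgroup.centralizer (Subgroup.centralizer (N : Set G) : Set G) :=
        Subgroup.le_centralizer_iff.1 le_rfl
      obtain ⟨p, hp, hpg⟩ := C.regular (fun a ha hx => semireg hNC hCtr ha hx)
        (cj_normal g hN).le hNne
      apply hab
      apply zen_comm
      exact hmin _ (normal_of_cj fun x => zen_cj (cj_normal x hN).le) (zen_ne_bot hNne hp hpg)
        inf_le_left
    refine ⟨N, hN, ?_, ?_, hcent⟩
    swap
    · by_contra hcon
      push Not at hcon
      exact hab fun a ha b hb => congrArg Subtype.val (hcon ⟨a, ha⟩ ⟨b, hb⟩)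
    -- minimal normal subgroup of `N`
    obtain ⟨T, ⟨hTN, hTn, hTne⟩, hTmin⟩ := Set.Finite.exists_minimal
      (Set.toFinite {T : Subgroup G | T ≤ N ∧ (∀ n ∈ N, cj n T ≤ T) ∧ T ≠ ⊥})
      ⟨N, le_rfl, fun n _ => (cj_normal n hN).le, hNne⟩
    have hTm : ∀ M : Subgroup G, (∀ n ∈ N, cj n M ≤ M) → M ≠ ⊥ → M ≤ T → M = T :=
      fun M h1 h2 h3 => le_antisymm h3 (hTmin ⟨h3.trans hTN, h1, h2⟩ h3)
    by_cases hTeq : T = N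
    · subst hTeq
      rw [isSimpleGroup_iff]
      refine ⟨(Subgroup.nontrivial_iff_ne_bot T).2 hNne, fun H hH => ?_⟩
      by_cases hHb : H = ⊥
      · exact Or.inl hHb
      right
      have h1 : H.map T.subtype = T := by
        apply hTm
        · rintro n hn y hy
          rw [mem_cj] at hy
          obtain ⟨z, hz, hzy⟩ := hy
          refine ⟨_, hH.conj_mem z hz ⟨n, hn⟩, ?_⟩
          have hzy' : (z : G) = n⁻¹ * y * n := hzy
          simp [hzy', mul_assoc]
        · intro hb
          exact hHb ((Subgroup.map_eq_bot_iff_of_injective _ T.subtype_injective).1 hb)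
        · rintro _ ⟨z, _, rfl⟩; exact z.2
      rw [eq_top_iff]
      intro x _
      have hx : (x : G) ∈ H.map T.subtype := by rw [h1]; exact x.2
      obtain ⟨z, hz, hzx⟩ := hx
      have : z = x := Subtype.ext hzx
      rwa [← this]
    exfalso
    -- conjugates of `T`
    have hcjN : ∀ x, cj x T ≤ N := fun x => by
      rw [← cj_normal x hN]; exact cj_mono _ hTN
    have hcjn : ∀ x, ∀ n ∈ N, cj n (cj x T) ≤ cj x T := by
      intro x n hn
      have h1 : x⁻¹ * n * x ∈ N := by
        have := hN.conj_mem n hn x⁻¹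
        simpa using this
      have h2 := cj_mono x (hTn _ h1)
      rw [← cj_mul] at h2 ⊢
      rwa [show x * (x⁻¹ * n * x) = n * x by group] at h2
    have hdisj : ∀ x, cj x T ≠ T → T ≤ Subgroup.centralizer (cj x T : Set G) := by
      intro x hx
      have hI : T ⊓ cj x T = ⊥ := by
        by_contra hne
        have h1 : T ⊓ cj x T = T := by
          apply hTm _ _ hne inf_le_left
          intro n hn y hy
          rw [mem_cj] at hy
          exact ⟨hTn n hn (mem_cj.2 hy.1), hcjn x n hn (mem_cj.2 hy.2)⟩
        have h2 : T ≤ cj x T := inf_eq_left.1 h1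
        apply hx
        symm
        apply Subgroup.eq_of_le_of_card_ge h2
        exact (Nat.card_congr (T.equivMapOfInjective _ (MulAut.conj x).injective).toEquiv).ge
      rw [cent_iff]
      intro a ha b hb
      have h1 : a * b * a⁻¹ * b⁻¹ ∈ T ⊓ cj x T := by
        refine ⟨?_, ?_⟩
        · have h3 : b * a⁻¹ * b⁻¹ ∈ T := hTn b (hcjN x hb) (cj_mem (T.inv_mem ha))
          have := T.mul_mem ha h3
          simpa [mul_assoc] using this
        · have h3 : a * b * a⁻¹ ∈ cj x T := hcjn x a (hTN ha) (cj_mem hb)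
          exact Subgroup.mul_mem _ h3 (Subgroup.inv_mem _ hb)
      rw [hI, Subgroup.mem_bot] at h1
      have h2 := mul_inv_eq_one.1 h1
      exact mul_inv_eq_iff_eq_mul.1 h2
    have hdisj2 : ∀ x y, cj x T ≠ cj y T → cj x T ≤ Subgroup.centralizer (cj y T : Set G) := by
      intro x y hxy
      have h1 : cj (x⁻¹ * y) T ≠ T := by
        intro he
        apply hxy
        rw [cj_mul] at he
        rw [← cj_cj_inv x (cj y T), he]
      have h2 := cent_iff.1 (hdisj _ h1)
      rw [cent_iff]
      intro a ha b hb
      rw [mem_cj] at ha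
      have hb' : x⁻¹ * b * x ∈ cj (x⁻¹ * y) T := by
        rw [mem_cj] at hb ⊢
        simpa [mul_assoc] using hb
      have h3 := h2 _ ha _ hb'
      have e1 : x⁻¹ * a * x * (x⁻¹ * b * x) = x⁻¹ * (a * b) * x := by group
      have e2 : x⁻¹ * b * x * (x⁻¹ * a * x) = x⁻¹ * (b * a) * x := by group
      rw [e1, e2] at h3
      simpa using h3
    have hTna : ¬ ∀ a ∈ T, ∀ b ∈ T, a * b = b * a := by
      intro hTab
      have hall : ∀ x, cj x T ≤ Subgroup.centralizer (T : Set G) := by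
        intro x
        by_cases hx : cj x T = T
        · rw [hx]; exact cent_iff.2 hTab
        · exact Subgroup.le_centralizer_iff.1 (hdisj x hx)
      have hnc : N ≤ Subgroup.centralizer (T : Set G) := by
        have h1 : Subgroup.normalClosure (T : Set G) = N := by
          apply hmin _ inferInstance
          · intro hb
            apply hTne
            rw [eq_bot_iff, ← hb]
            exact Subgroup.subset_normalClosure
          · exact Subgroup.normalClosure_le_normal hTN
        rw [← h1, Subgroup.normalClosure, Subgroup.closure_le]
        intro y hy
        obtain ⟨t, ht, hty⟩ := Group.mem_conjugatesOfSet_iff.1 hy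
        obtain ⟨c, hc⟩ := isConj_iff.1 hty
        rw [← hc]
        exact hall c (cj_mem ht)
      have h2 := Subgroup.le_centralizer_iff.1 hnc
      rw [hcent] at h2
      exact hTne (eq_bot_iff.2 h2)
    by_cases hgT : cj g T = T
    · have hTtr : Trans P T := C.trans hTN hNtr hTn hgT.le hTne
      have hex : ∃ x, cj x T ≠ T := by
        by_contra hcon
        push Not at hcon
        exact hTeq (hmin T (normal_of_cj fun x => (hcon x).le) hTne hTN)
      obtain ⟨x, hx⟩ := hex
      obtain ⟨p, hp, hpg⟩ := C.regular
        (fun a ha hy => semireg (hdisj x hx) (trans_cj hTtr x) ha hy) hgT.le hTne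
      apply hTna
      apply zen_comm
      exact hTm _ (fun n hn => zen_cj (hTn n hn)) (zen_ne_bot hTne hp hpg) inf_le_left
    · refine tower C hrh hh hv hN hNtr hTN hTn hTna ?_
      have key : ∀ i j, i < j → j < r → cj (g ^ i) T ≠ cj (g ^ j) T := by
        intro i j hij hj he
        apply hgT
        obtain ⟨d, rfl⟩ := Nat.exists_eq_add_of_lt hij
        have h1 : cj (g ^ (d + 1)) T = T := by
          rw [add_assoc, pow_add, cj_mul] at he
          have := congrArg (cj (g ^ i)⁻¹) he
          rw [cj_inv_cj, cj_inv_cj] at this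
          exact this.symm
        have hcop : Nat.Coprime (d + 1) r := by
          apply Nat.Coprime.symm
          rw [C.hr.coprime_iff_not_dvd]
          intro hd
          have := Nat.le_of_dvd (by omega) hd
          omega
        obtain ⟨m, _, hm⟩ := Nat.exists_mul_mod_eq_one_of_coprime hcop C.hr.one_lt
        have h2 : g ^ ((d + 1) * m) = g := by
          rw [← Nat.div_add_mod ((d + 1) * m) r, hm, pow_add, pow_mul, C.gr, one_pow, one_mul,
            pow_one]
        have h3 := cj_pow h1 m
        rwa [← pow_mul, h2] at h3
      intro i j hi hj hij
      apply hdisj2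
      rcases Nat.lt_or_gt_of_ne hij with h1 | h1
      · exact key i j h1 hj
      · exact (key j i h1 hi).symm

end Grp

section Design

variable {P : Type*} [Fintype P] [DecidableEq P]

theorem double_count (F : Finset (Finset P)) (S : Finset P) :
    ∑ B ∈ F, (B ∩ S).card = ∑ y ∈ S, (F.filter fun B => y ∈ B).card := by
  have e : ∀ B ∈ F, (B ∩ S).card = ∑ y ∈ S, if y ∈ B then 1 else 0 := by
    intro B _
    rw [← Finset.sum_filter, Finset.sum_const, smul_eq_mul, mul_one, Finset.filter_mem_eq_inter,
      Finset.inter_comm]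
  rw [Finset.sum_congr rfl e, Finset.sum_comm]
  apply Finset.sum_congr rfl
  intro y _
  rw [← Finset.sum_filter, Finset.sum_const, smul_eq_mul, mul_one]

theorem count_pairs {blocks : Finset (Finset P)} {v k lam r : ℕ}
    (hD : IsTwoDesign blocks v k lam) (hrepl : ∀ x : P, pointDegree blocks x = r)
    (S : Finset P) {α : P} (hα : α ∈ S) :
    ∑ B ∈ blocks.filter (fun B => α ∈ B), (B ∩ S).card = r + (S.card - 1) * lam := by
  rw [double_count, ← Finset.add_sum_erase S _ hα]
  congr 1
  · rw [Finset.filter_filter]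
    simp only [and_self]
    exact hrepl α
  · rw [← Finset.card_erase_of_mem hα]
    apply Finset.sum_const_nat
    intro y hy
    rw [Finset.filter_filter]
    exact hD.2.2.2.2 α y (Finset.ne_of_mem_erase hy).symm

theorem param_one {blocks : Finset (Finset P)} {v k lam r : ℕ}
    (hD : IsTwoDesign blocks v k lam) (hrepl : ∀ x : P, pointDegree blocks x = r) (α : P) :
    r * k = r + (v - 1) * lam := by
  have h := count_pairs hD hrepl Finset.univ (Finset.mem_univ α)
  rw [Finset.card_univ, hD.1] at h
  rw [← h, Finset.sum_const_nat (m := k), ← hrepl α]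
  · rfl
  · intro B hB
    rw [Finset.inter_univ]
    exact hD.2.2.2.1 B (Finset.mem_filter.1 hB).1

theorem fisher {blocks : Finset (Finset P)} {v k lam r : ℕ}
    (hD : IsTwoDesign blocks v k lam) (hk : 2 < k) (hkv : k < v - 1) (hr : 0 < r)
    (hrepl : ∀ x : P, pointDegree blocks x = r) (α : P) : k ≤ r := by
  have hp1 := param_one hD hrepl α
  have hne : (blocks.filter fun B => α ∈ B).Nonempty := by
    rw [← Finset.card_pos]; have := hrepl α; unfold pointDegree at this; omega
  obtain ⟨B₀, hB₀'⟩ := hne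
  have hB₀ := (Finset.mem_filter.1 hB₀').1
  have hc0 := hD.2.2.2.1 B₀ hB₀
  have h1 : blocks.card * k = v * r := by
    have h := double_count blocks Finset.univ
    rw [Finset.sum_const_nat (m := k), Finset.sum_const_nat (m := r), Finset.card_univ, hD.1] at h
    · exact h
    · intro x _; exact hrepl x
    · intro B hB; rw [Finset.inter_univ]; exact hD.2.2.2.1 B hB
  have h2 : ∑ B ∈ blocks, (B ∩ B₀).card = k * r := by
    rw [double_count, Finset.sum_const_nat (m := r), hc0]
    intro x _; exact hrepl x
  have h3 : ∑ B ∈ blocks, (B ∩ B₀).card ^ 2 = k * (r + (k - 1) * lam) := by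
    have e : ∀ B ∈ blocks, (B ∩ B₀).card ^ 2 =
        ∑ y ∈ B₀, if y ∈ B then (B ∩ B₀).card else 0 := by
      intro B _
      rw [← Finset.sum_filter, Finset.sum_const, sq, smul_eq_mul, Finset.filter_mem_eq_inter,
        Finset.inter_comm B₀ B]
    rw [Finset.sum_congr rfl e, Finset.sum_comm, Finset.sum_const_nat
      (m := r + (k - 1) * lam), hc0]
    intro y hy
    rw [← Finset.sum_filter, count_pairs hD hrepl B₀ hy, hc0]
  have hcs := sq_sum_le_card_mul_sum_sq (s := blocks.erase B₀)
    (f := fun B => ((B ∩ B₀).card : ℤ))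
  have h2' : ∑ B ∈ blocks.erase B₀, ((B ∩ B₀).card : ℤ) = k * r - k := by
    have h := Finset.add_sum_erase blocks (fun B => ((B ∩ B₀).card : ℤ)) hB₀
    have h' : ∑ B ∈ blocks, ((B ∩ B₀).card : ℤ) = k * r := by exact_mod_cast h2
    simp only [Finset.inter_self, hc0] at h
    rw [h'] at h
    linarith
  have h3' : ∑ B ∈ blocks.erase B₀, ((B ∩ B₀).card : ℤ) ^ 2 =
      k * (r + (k - 1) * lam) - k ^ 2 := by
    have h := Finset.add_sum_erase blocks (fun B => ((B ∩ B₀).card : ℤ) ^ 2) hB₀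
    have h' : ∑ B ∈ blocks, ((B ∩ B₀).card : ℤ) ^ 2 = k * (r + (k - 1) * lam) := by
      have : ((k - 1 : ℕ) : ℤ) = (k : ℤ) - 1 := by push_cast [show 1 ≤ k by omega]; ring
      rw [← this]
      exact_mod_cast h3
    simp only [Finset.inter_self, hc0] at h
    rw [h'] at h
    linarith
  have hbc : ((blocks.erase B₀).card : ℤ) = blocks.card - 1 := by
    rw [Finset.card_erase_of_mem hB₀]
    have := Finset.card_pos.2 ⟨B₀, hB₀⟩
    push_cast [show 1 ≤ blocks.card by omega]; ring
  rw [h2', h3', hbc] at hcs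
  have h1z : (blocks.card : ℤ) * k = v * r := by exact_mod_cast h1
  have hp1z : (r : ℤ) * k = r + (v - 1) * lam := by
    have : ((v - 1 : ℕ) : ℤ) = (v : ℤ) - 1 := by push_cast [show 1 ≤ v by omega]; ring
    rw [← this]; exact_mod_cast hp1
  by_contra hlt
  push Not at hlt
  have hkz : (0 : ℤ) < k := by exact_mod_cast (by omega : 0 < k)
  have hrz : (0 : ℤ) < r := by exact_mod_cast hr
  have hvz : (0 : ℤ) < (v : ℤ) - 1 := by
    have : 1 < v := by omega
    have : (1 : ℤ) < v := by exact_mod_cast this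
    linarith
  have hvk : (0 : ℤ) < (v : ℤ) - k := by
    have : k < v := by omega
    have : (k : ℤ) < v := by exact_mod_cast this
    linarith
  have hltz : (0 : ℤ) < (k : ℤ) - r := by
    have : (r : ℤ) < k := by exact_mod_cast hlt
    linarith
  generalize (blocks.card : ℤ) = b at *
  have hm := mul_le_mul_of_nonneg_left hcs (mul_pos hkz hvz).le
  have e1 : (k : ℤ) * (v - 1) * ((b - 1) * (k * (r + (k - 1) * lam) - k ^ 2))
      = k * (v * r - k) * ((r - k) * (v - 1) + r * (k - 1) ^ 2) := by
    have a1 : (b - 1) * k = v * r - k := by linarith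
    have a2 : ((v : ℤ) - 1) * lam = r * (k - 1) := by linarith
    calc (k : ℤ) * (v - 1) * ((b - 1) * (k * (r + (k - 1) * lam) - k ^ 2))
        = k * ((b - 1) * k) * ((r - k) * (v - 1) + (k - 1) * ((v - 1) * lam)) := by ring
      _ = _ := by rw [a1, a2]; ring
  rw [e1] at hm
  have hpos : (0 : ℤ) < k * r * (k - r) * (v - k) ^ 2 := by positivity
  nlinarith

theorem exists_elt {blocks : Finset (Finset P)} {v k lam r : ℕ}
    (hD : IsTwoDesign blocks v k lam) (hk : 2 < k) (hkv : k < v - 1)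
    (hr : r.Prime) (hrepl : ∀ x : P, pointDegree blocks x = r)
    (G : Subgroup (Equiv.Perm P)) (hAut : IsAutGroup blocks G)
    (hFT : IsFlagTransitive blocks G) (α : P) (hkr : k ≤ r) (hlr : lam < r) :
    ∃ g : G, g ^ r = 1 ∧ ∀ β : P, g • β = β ↔ β = α := by
  have : Fact r.Prime := ⟨hr⟩
  have hsm : ∀ (g : G) (B : Finset P), g • B = B.image g.1 := fun g B => rfl
  have hΩc : (blocks.filter fun B => α ∈ B).card = r := hrepl α
  have hne : (blocks.filter fun B => α ∈ B).Nonempty := by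
    rw [← Finset.card_pos, hΩc]; exact hr.pos
  obtain ⟨B₀, hB₀'⟩ := hne
  obtain ⟨hB₀, hαB₀⟩ := Finset.mem_filter.1 hB₀'
  let S := MulAction.stabilizer G α
  have horb : MulAction.orbit S B₀ = ((blocks.filter fun B => α ∈ B : Finset (Finset P)) : 
      Set (Finset P)) := by
    ext B
    rw [Finset.mem_coe, Finset.mem_filter]
    constructor
    · rintro ⟨s, rfl⟩
      refine ⟨hAut s.1.1 s.1.2 B₀ hB₀, ?_⟩
      have h1 : s.1 • α = α := s.2
      have : s.1 • α ∈ s.1 • B₀ := Finset.smul_mem_smul_finset hαB₀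
      rw [h1] at this
      exact this
    · rintro ⟨hB, hαB⟩
      obtain ⟨x, hx, hxα, hxB⟩ := hFT B₀ hB₀ B hB α hαB₀ α hαB
      exact ⟨⟨⟨x, hx⟩, hxα⟩, hxB⟩
  have hdvd : r ∣ Nat.card S := by
    have h1 := MulAction.index_stabilizer S B₀
    rw [horb, Set.ncard_coe_finset, hΩc] at h1
    rw [← h1]
    exact Subgroup.index_dvd_card _
  obtain ⟨s, hs⟩ := exists_prime_orderOf_dvd_card' r hdvd
  have hsr : s ^ r = 1 := by rw [← hs]; exact pow_orderOf_eq_one s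
  have hs1 : s ≠ 1 := by
    rintro rfl
    rw [orderOf_one] at hs
    exact hr.one_lt.ne hs
  obtain ⟨g, hgα⟩ := s
  have hgr : g ^ r = 1 := congrArg Subtype.val hsr
  have hg1 : g ≠ 1 := fun h => hs1 (Subtype.ext h)
  have hgα : g • α = α := hgα
  have hitB : (fun B : Finset P => g • B)^[r] = id := by
    rw [smul_iterate, hgr]; funext Q; exact one_smul _ _
  have hitP : (fun x : P => g • x)^[r] = id := by
    rw [smul_iterate, hgr]; funext Q; exact one_smul _ _
  have hgb : ∀ B ∈ blocks, g • B ∈ blocks := fun B hB => hAut g.1 g.2 B hB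
  have hgm : ∀ (B : Finset P) (x : P), x ∈ B → g • x ∈ g • B :=
    fun B x hx => Finset.smul_mem_smul_finset hx
  -- `g` moves some block through `α`
  have hmove : ∃ B ∈ blocks.filter (fun B => α ∈ B), g • B ≠ B := by
    by_contra hcon
    push Not at hcon
    apply hg1
    apply Subtype.ext
    ext β
    by_contra hβ
    have hβ' : g • β ≠ β := hβ
    have hβα : α ≠ β := by rintro rfl; exact hβ' hgα
    have hlc := hD.2.2.2.2 α β hβα
    have hl1 := hD.2.2.1
    obtain ⟨B, hB⟩ := Finset.card_pos.1 (by rw [hlc]; omega :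
      0 < (blocks.filter fun B => α ∈ B ∧ β ∈ B).card)
    obtain ⟨hBb, hαB, hβB⟩ := Finset.mem_filter.1 hB
    have hgB := hcon B (Finset.mem_filter.2 ⟨hBb, hαB⟩)
    have h := ncard_modEq hr (fun x : P => g • x) hitP (B : Set P) (by
      intro x hx
      have := hgm B x hx
      rw [hgB] at this
      exact this)
    rw [Set.ncard_coe_finset, hD.2.2.2.1 B hBb] at h
    have hsub : {x ∈ (B : Set P) | g • x = x} ⊆ (B.erase β : Finset P) := by
      rintro x ⟨hx, hx'⟩
      rw [Finset.mem_coe, Finset.mem_erase]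
      exact ⟨by rintro rfl; exact hβ' hx', hx⟩
    have hle := Set.ncard_le_ncard hsub
    rw [Set.ncard_coe_finset, Finset.card_erase_of_mem hβB, hD.2.2.2.1 B hBb] at hle
    have hpos : 0 < {x ∈ (B : Set P) | g • x = x}.ncard :=
      (Set.ncard_pos (Set.toFinite _)).2 ⟨α, hαB, hgα⟩
    obtain ⟨c, hc⟩ := (Nat.modEq_iff_dvd' (by omega)).1 h.symm
    rcases Nat.eq_zero_or_pos c with h0 | h0
    · subst h0; omega
    · have : r ≤ r * c := Nat.le_mul_of_pos_right r h0
      omega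
  have hnofix : ∀ B ∈ blocks, α ∈ B → g • B ≠ B := by
    intro B₁ hB₁ hαB₁ hfix
    obtain ⟨B₂, hB₂, hB₂'⟩ := hmove
    have h := ncard_modEq hr (fun B : Finset P => g • B) hitB
      ((blocks.filter fun B => α ∈ B : Finset (Finset P)) : Set (Finset P)) (by
        intro B hB
        obtain ⟨h1, h2⟩ := Finset.mem_filter.1 (Finset.mem_coe.1 hB)
        refine Finset.mem_coe.2 (Finset.mem_filter.2 ⟨hgb B h1, ?_⟩)
        have := hgm B α h2
        rwa [hgα] at this)
    have hsub : {B ∈ ((blocks.filter fun B => α ∈ B : Finset (Finset P)) : Set (Finset P)) |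
        g • B = B} ⊆ ((blocks.filter fun B => α ∈ B).erase B₂ : Finset (Finset P)) := by
      rintro x ⟨hx, hx'⟩
      rw [Finset.mem_coe, Finset.mem_erase]
      exact ⟨by rintro rfl; exact hB₂' hx', hx⟩
    have hle := Set.ncard_le_ncard hsub
    rw [Set.ncard_coe_finset, Finset.card_erase_of_mem hB₂, hΩc] at hle
    have hpos : 0 < {B ∈ ((blocks.filter fun B => α ∈ B : Finset (Finset P)) :
        Set (Finset P)) | g • B = B}.ncard :=
      (Set.ncard_pos (Set.toFinite _)).2
        ⟨B₁, Finset.mem_coe.2 (Finset.mem_filter.2 ⟨hB₁, hαB₁⟩), hfix⟩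
    rw [Set.ncard_coe_finset, hΩc] at h
    have h0 : r ≡ 0 [MOD r] := by simp [Nat.ModEq]
    have := Nat.le_of_dvd hpos (Nat.modEq_zero_iff_dvd.1 (h.symm.trans h0))
    have := hr.pos
    omega
  refine ⟨g, hgr, fun β => ⟨fun hβ => ?_, by rintro rfl; exact hgα⟩⟩
  by_contra hβα
  have hlc := hD.2.2.2.2 α β (Ne.symm hβα)
  have hl1 := hD.2.2.1
  have h := ncard_modEq hr (fun B : Finset P => g • B) hitB
    ((blocks.filter fun B => α ∈ B ∧ β ∈ B : Finset (Finset P)) : Set (Finset P)) (by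
      intro B hB
      obtain ⟨h1, h2, h3⟩ := Finset.mem_filter.1 (Finset.mem_coe.1 hB)
      have h2' := hgm B α h2
      have h3' := hgm B β h3
      rw [hgα] at h2'
      rw [hβ] at h3'
      exact Finset.mem_coe.2 (Finset.mem_filter.2 ⟨hgb B h1, h2', h3'⟩))
  have he : {B ∈ ((blocks.filter fun B => α ∈ B ∧ β ∈ B : Finset (Finset P)) :
      Set (Finset P)) | g • B = B} = ∅ := by
    rw [Set.eq_empty_iff_forall_notMem]
    rintro B ⟨hB, hB'⟩
    obtain ⟨h1, h2, h3⟩ := Finset.mem_filter.1 (Finset.mem_coe.1 hB)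
    exact hnofix B h1 h2 hB'
  rw [he, Set.ncard_empty, Set.ncard_coe_finset, hlc] at h
  have := Nat.le_of_dvd hl1 (Nat.modEq_zero_iff_dvd.1 h)
  omega

end Design

end FlagPrime

/-- A flag-transitive automorphism group of a nontrivial 2-design with prime
replication number is point-primitive of affine or almost simple type: either it
has an elementary abelian normal subgroup acting regularly on the points, or it
has a nonabelian simple normal subgroup with trivial centraliser. -/
theorem flag_transitive_affine_or_almost_simple [Fintype P] [DecidableEq P]
    (blocks : Finset (Finset P)) (v k lam r : ℕ)
    (hD : IsTwoDesign blocks v k lam) (hk : 2 < k) (hkv : k < v - 1)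
    (hr : r.Prime) (hrepl : ∀ x : P, pointDegree blocks x = r)
    (G : Subgroup (Equiv.Perm P)) (hAut : IsAutGroup blocks G)
    (hFT : IsFlagTransitive blocks G) :
    (MulAction.IsPretransitive G P ∧
      ∀ s : Set P, MulAction.IsBlock G s → s.Subsingleton ∨ s = Set.univ) ∧
    ((∃ N : Subgroup G, N.Normal ∧
        (∀ a ∈ N, ∀ b ∈ N, a * b = b * a) ∧
        (∃ p : ℕ, p.Prime ∧ ∀ g ∈ N, g ≠ 1 → orderOf g = p) ∧
        (∀ x y : P, ∃ g ∈ N, g • x = y) ∧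
        (∀ g ∈ N, ∀ x : P, g • x = x → g = 1)) ∨
      (∃ X : Subgroup G, X.Normal ∧ IsSimpleGroup X ∧
        (∃ a b : X, a * b ≠ b * a) ∧
        Subgroup.centralizer (X : Set G) = ⊥)) := by
  have hv2 : 2 ≤ v := hD.2.1
  have hcv : Nat.card P = v := by rw [Nat.card_eq_fintype_card]; exact hD.1
  have hnt : Nontrivial P := Fintype.one_lt_card_iff_nontrivial.1 (by rw [hD.1]; omega)
  obtain ⟨α, _, _⟩ := exists_pair_ne P
  have hkr := FlagPrime.fisher hD hk hkv hr.pos hrepl α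
  have hp1 := FlagPrime.param_one hD hrepl α
  have hl1 : 1 ≤ lam := hD.2.2.1
  obtain ⟨w, rfl⟩ : ∃ w, v = w + 1 := ⟨v - 1, by omega⟩
  obtain ⟨c, rfl⟩ : ∃ c, k = c + 1 := ⟨k - 1, by omega⟩
  rw [Nat.add_sub_cancel] at hp1
  have hp2 : r * c = w * lam := by
    rw [Nat.mul_add, Nat.mul_one] at hp1; omega
  have hlr : lam < r := by
    by_contra hcon
    push Not at hcon
    have : c < w := by omega
    nlinarith [hr.pos]
  obtain ⟨g, hgr, hgfix⟩ :=
    FlagPrime.exists_elt hD hk hkv hr hrepl G hAut hFT α hkr hlr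
  have hodd : Odd r := hr.odd_of_ne_two (by omega)
  obtain ⟨h, hrh⟩ := hodd
  have hwle : w ≤ r * (r - 1) := by
    calc w ≤ w * lam := Nat.le_mul_of_pos_right w hl1
      _ = r * c := hp2.symm
      _ ≤ _ := Nat.mul_le_mul_left r (by omega)
  have hbound : w + 1 ≤ 4 * h ^ 2 + 2 * h + 1 := by
    have : r * (r - 1) = 4 * h ^ 2 + 2 * h := by
      rw [hrh, Nat.add_sub_cancel]; ring
    omega
  have hC : FlagPrime.Ctx α g r := by
    refine ⟨hr, hgr, hgfix, ?_⟩
    rw [hcv]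
    refine lt_of_le_of_lt hbound ?_
    rw [hrh]; nlinarith
  have hpre : MulAction.IsPretransitive G P := by
    refine ⟨fun x y => ?_⟩
    have hex : ∀ x : P, ∃ B ∈ blocks, x ∈ B := by
      intro x
      have hx : (blocks.filter fun B => x ∈ B).card = r := hrepl x
      obtain ⟨B, hB⟩ := Finset.card_pos.1 (by rw [hx]; exact hr.pos)
      exact ⟨B, (Finset.mem_filter.1 hB).1, (Finset.mem_filter.1 hB).2⟩
    obtain ⟨B₁, hB₁, hx⟩ := hex x
    obtain ⟨B₂, hB₂, hy⟩ := hex y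
    obtain ⟨m, hm, e, _⟩ := hFT B₁ hB₁ B₂ hB₂ x hx y hy
    exact ⟨⟨m, hm⟩, e⟩
  refine ⟨⟨hpre, fun s hs => hC.prim s hs⟩, ?_⟩
  exact FlagPrime.dichotomy hC hpre hrh (by omega) (by rw [hcv]; exact hbound)
end

section
/- Let q ≥ 2 and n ≥ 3 be integers, and let r be a prime dividing (q^{n−1}−1)/(q−1) such that (q^n−1)/(q−1) < r². Then r is a primitive divisor: r does not divide q^i − 1 for any i with 1 ≤ i ≤ n−2. -/
/-- If `q ≥ 2`, `n ≥ 3`, and `r` is a prime dividing `(q^(n-1) - 1)/(q - 1)` with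
`(q^n - 1)/(q - 1) < r²`, then `r` is a primitive divisor: `r` does not divide
`q^i - 1` for any `1 ≤ i ≤ n - 2`. -/
theorem primitive_divisor_of_sq_gt (q n r : ℕ) (hq : 2 ≤ q) (hn : 3 ≤ n)
    (hr : r.Prime) (hdvd : r ∣ (q ^ (n - 1) - 1) / (q - 1))
    (hlt : (q ^ n - 1) / (q - 1) < r ^ 2) :
    ∀ i : ℕ, 1 ≤ i → i ≤ n - 2 → ¬ r ∣ q ^ i - 1 := by
  intro i hi hin hri
  have hm : r ∣ q ^ (n - 1) - 1 :=
    hdvd.trans (Nat.div_dvd_of_dvd (by simpa using Nat.sub_dvd_pow_sub_pow q 1 (n - 1)))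
  have hg : r ∣ q ^ (Nat.gcd i (n - 1)) - 1 := by
    rw [← Nat.pow_sub_one_gcd_pow_sub_one]
    exact Nat.dvd_gcd hri hm
  obtain ⟨k, hk⟩ := Nat.gcd_dvd_right i (n - 1)
  have hle : Nat.gcd i (n - 1) ≤ i := Nat.gcd_le_left _ hi
  have hpos : 0 < Nat.gcd i (n - 1) := Nat.gcd_pos_of_pos_left _ hi
  generalize Nat.gcd i (n - 1) = d at *
  have hk2 : 2 ≤ k := by
    by_contra h
    have : k = 0 ∨ k = 1 := by omega
    rcases this with rfl | rfl <;> omega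
  have hd : d * 2 ≤ n - 1 := hk ▸ Nat.mul_le_mul_left d hk2
  have hqd : 1 < q ^ d := Nat.one_lt_pow hpos.ne' hq
  have hrle : r ≤ q ^ d - 1 := Nat.le_of_dvd (by omega) hg
  have h1 : r ^ 2 ≤ q ^ (n - 1) :=
    calc r ^ 2 ≤ (q ^ d) ^ 2 := Nat.pow_le_pow_left (by omega) 2
      _ = q ^ (d * 2) := (pow_mul q d 2).symm
      _ ≤ q ^ (n - 1) := Nat.pow_le_pow_right (by omega) hd
  have h2 : q ^ (n - 1) ≤ (q ^ n - 1) / (q - 1) := by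
    rw [Nat.le_div_iff_mul_le (by omega), Nat.mul_sub, mul_one, ← pow_succ,
      Nat.sub_add_cancel (by omega)]
    have : 1 ≤ q ^ (n - 1) := Nat.one_le_pow _ _ (by omega)
    omega
  omega
end

section
/- Let q ≥ 2 be an integer and let r be a prime such that r divides q²+1 and q²(q²−1) < 2r². Then r = q²+1; in particular q²+1 is prime and q is even. -/
/-- If `q ≥ 2` and `r` is a prime dividing `q² + 1` with `q²(q² - 1) < 2r²`, then
`r = q² + 1`; in particular `q² + 1` is prime and `q` is even. -/
theorem prime_divisor_eq_q_sq_add_one (q r : ℕ) (hq : 2 ≤ q) (hr : r.Prime)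
    (hdvd : r ∣ q ^ 2 + 1) (hlt : q ^ 2 * (q ^ 2 - 1) < 2 * r ^ 2) :
    r = q ^ 2 + 1 ∧ (q ^ 2 + 1).Prime ∧ Even q := by
  have key : r = q ^ 2 + 1 := by
    rcases Nat.lt_or_ge q 3 with h | h
    · obtain rfl : q = 2 := by omega
      have h5 : Nat.Prime 5 := by norm_num
      exact (Nat.prime_dvd_prime_iff_eq hr h5).1 (by simpa using hdvd)
    · obtain ⟨k, hk⟩ := hdvd
      have hx : 9 ≤ q ^ 2 := by nlinarith
      generalize q ^ 2 = x at *
      obtain ⟨y, rfl⟩ : ∃ y, x = y + 1 := ⟨x - 1, by omega⟩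
      simp only [Nat.add_sub_cancel] at hlt
      rcases Nat.lt_or_ge k 2 with h2 | h2
      · interval_cases k <;> omega
      · exfalso
        have h3 : 2 * r ≤ y + 1 + 1 := by nlinarith
        nlinarith
  have hp : (q ^ 2 + 1).Prime := key ▸ hr
  refine ⟨key, hp, ?_⟩
  rcases hp.eq_two_or_odd' with h | h
  · nlinarith
  · by_contra hne
    have ho : Odd (q ^ 2) := (Nat.not_even_iff_odd.1 hne).pow
    exact (Nat.not_even_iff_odd.2 h) (ho.add_odd odd_one)
end

section
/- Neither the alternating group Alt₈ on 8 letters nor the symmetric group Sym₈ on 8 letters has a subgroup of index 14. -/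
open scoped Pointwise in
open MulAction Equiv.Perm in
/-- A subgroup of `Sym₈` whose order is divisible by `5` but not by `7` preserves a set of
size `5`, `6` or `7`. -/
theorem exists_invariant_set (G : Subgroup (Equiv.Perm (Fin 8)))
    (h5 : 5 ∣ Nat.card G) (h7 : ¬ 7 ∣ Nat.card G) :
    ∃ s : Set (Fin 8), (5 ≤ s.ncard ∧ s.ncard ≤ 7) ∧ ∀ g ∈ G, g • s = s := by
  classical
  have : Fact (Nat.Prime 5) := ⟨by norm_num⟩
  obtain ⟨⟨c, hc⟩, hord⟩ := exists_prime_orderOf_dvd_card' 5 h5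
  rw [Subgroup.orderOf_mk] at hord
  have hcyc : c.IsCycle := isCycle_of_prime_order' (by rw [hord]; norm_num) (by rw [hord]; simp)
  have hsupp : c.support.card = 5 := by rw [← hcyc.orderOf, hord]
  have hne : ∃ x, c x ≠ x := by obtain ⟨x, hx, -⟩ := hcyc; exact ⟨x, hx⟩
  obtain ⟨x, hx⟩ := hne
  have hsub : (c.support : Set (Fin 8)) ⊆ orbit G x := by
    intro y hy
    have hy' : c y ≠ y := by simpa using hy
    obtain ⟨i, hi⟩ := hcyc.sameCycle hx hy'
    exact ⟨⟨c ^ i, zpow_mem hc i⟩, hi⟩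
  have hge : 5 ≤ (orbit G x).ncard := by
    have := Set.ncard_le_ncard hsub (Set.toFinite _)
    rwa [Set.ncard_coe_finset, hsupp] at this
  refine ⟨orbit G x, ⟨hge, ?_⟩, fun g hg => smul_orbit (⟨g, hg⟩ : G) x⟩
  by_contra hlt
  have huniv : orbit G x = Set.univ := by
    rw [Set.eq_univ_iff_ncard]
    have := Set.ncard_le_card (orbit G x)
    simp only [Nat.card_eq_fintype_card, Fintype.card_fin] at *
    omega
  have htrans : IsPretransitive G (Fin 8) := by
    rw [isPretransitive_iff_base x]
    intro y
    have : y ∈ orbit G x := by rw [huniv]; trivial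
    exact this
  have ht5 := isPretransitive_of_isCycle_mem hcyc hc
  set F := SubMulAction.ofFixingSubgroup G (c.support : Set (Fin 8))ᶜ with hF
  have hcard : Nat.card F = 5 := by
    rw [Nat.card_eq_fintype_card, Fintype.card_subtype, ← hsupp]
    apply congr_arg
    ext y
    simp [hF, SubMulAction.mem_ofFixingSubgroup_iff]
  have hprim5 : IsPreprimitive (fixingSubgroup G (c.support : Set (Fin 8))ᶜ) F :=
    IsPreprimitive.of_prime_card (by rw [hcard]; norm_num)
  let f : F →ₑ[(Subgroup.subtype _ : fixingSubgroup G (c.support : Set (Fin 8))ᶜ → G)] Fin 8 :=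
    { toFun := Subtype.val
      map_smul' := fun _ _ => rfl }
  have hprim : IsPreprimitive G (Fin 8) := by
    apply IsPreprimitive.of_card_lt (f := f)
    rw [Set.ncard_range_of_injective (f := f) Subtype.val_injective, hcard]
    simp
  have h2 : IsMultiplyPretransitive G (Fin 8) 2 := by
    refine hprim.is_two_pretransitive (s := (c.support : Set (Fin 8))ᶜ) (n := 2) ?_ (by simp) ht5
    have := Set.ncard_add_ncard_compl (c.support : Set (Fin 8))
    rw [Set.ncard_coe_finset, hsupp] at this
    simp at this ⊢
    omega
  have hidx := h2.index_of_fixingSubgroup_mul (s := ({0, 1} : Set (Fin 8)))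
    (Set.ncard_pair (by decide))
  simp [Nat.factorial] at hidx
  apply h7
  refine dvd_trans ?_ (Subgroup.index_dvd_card (fixingSubgroup G ({0, 1} : Set (Fin 8))))
  omega

open scoped Pointwise in
open MulAction in
/-- A group acting transitively on the `n`-subsets of `Fin 8` for all `n` cannot have a subgroup of
index `14` fixing a set of size `5`, `6` or `7`. -/
theorem no_index_of_invariant {M : Type*} [Group M] [MulAction M (Fin 8)]
    (ht : ∀ n, IsPretransitive M (Set.powersetCard (Fin 8) n)) (H : Subgroup M)
    (hH : H.index = 14) (s : Set (Fin 8)) (hs : 5 ≤ s.ncard ∧ s.ncard ≤ 7)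
    (hfix : ∀ g ∈ H, g • s = s) : False := by
  classical
  obtain ⟨t, rfl⟩ : ∃ t : Finset (Fin 8), (t : Set (Fin 8)) = s := ⟨s.toFinset, by simp⟩
  rw [Set.ncard_coe_finset] at hs
  obtain ⟨n, hn⟩ : ∃ n, t.card = n := ⟨_, rfl⟩
  let p : Set.powersetCard (Fin 8) n := ⟨t, hn⟩
  have hle : H ≤ stabilizer M p := by
    rw [Set.powersetCard.stabilizer_coe]
    intro g hg
    exact hfix g hg
  have hd := Subgroup.index_dvd_of_le hle
  have := ht n
  rw [index_stabilizer_of_transitive, hH, Set.powersetCard.card] at hd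
  rw [hn] at hs
  obtain ⟨h1, h2⟩ := hs
  simp only [Nat.card_eq_fintype_card, Fintype.card_fin] at hd
  interval_cases n <;> revert hd <;> decide

/-- Neither the alternating group `Alt₈` nor the symmetric group `Sym₈` on `8`
letters has a subgroup of index `14`. -/
theorem no_subgroup_of_index_fourteen :
    (∀ H : Subgroup (alternatingGroup (Fin 8)), H.index ≠ 14) ∧
      (∀ H : Subgroup (Equiv.Perm (Fin 8)), H.index ≠ 14) := by
  constructor
  · intro H hH
    have hc := H.card_mul_index
    rw [hH, nat_card_alternatingGroup] at hc
    simp [Nat.factorial] at hc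
    have hm : Nat.card (H.map (alternatingGroup (Fin 8)).subtype) = 1440 := by
      rw [Subgroup.card_map_of_injective (Subgroup.subtype_injective _)]
      omega
    obtain ⟨s, hs, hfix⟩ := exists_invariant_set (H.map (alternatingGroup (Fin 8)).subtype)
      (by rw [hm]; norm_num) (by rw [hm]; norm_num)
    exact no_index_of_invariant
      (fun n => Set.powersetCard.isPretransitive_alternatingGroup (by simp)) H hH s hs
      (fun g hg => hfix g ⟨g, hg, rfl⟩)
  · intro H hH
    have hc := H.card_mul_index
    rw [hH, Nat.card_perm] at hc
    simp [Nat.factorial] at hc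
    have hm : Nat.card H = 2880 := by
      omega
    obtain ⟨s, hs, hfix⟩ := exists_invariant_set H
      (by rw [hm]; norm_num) (by rw [hm]; norm_num)
    exact no_index_of_invariant
      (fun n => Set.powersetCard.isPretransitive) H hH s hs hfix
end
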